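/- Let s ≥ 0, σ > −1, 1 ≤ p, r ≤ ∞, and let f be a smooth divergence-free vector field and g a smooth function on ℝ^d, both with sufficient decay. Then the generalized commutator estimate holds: ‖[Λ^s, f·∇]g‖_{Ḃ^σ_{p,r}} ≤ C ( ‖∇f‖_{L^∞} ‖g‖_{Ḃ^{σ+s}_{p,r}} + ‖∇g‖_{L^∞} ‖f‖_{Ḃ^{σ+s}_{p,r}} ), where C is independent of f and g. -/

import Mathlib

open MeasureTheory Real FourierTransform ENNReal

noncomputable section

variable {d : ℕ}

/-- The fractional Laplacian `Λˢ = (−Δ)^{s/2}`, the Fourier multiplier with symbol `|ξ|ˢ`,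
realized as an inverse Fourier integral. -/
def fracLap (s : ℝ) (f : EuclideanSpace ℝ (Fin d) → ℂ) :
    EuclideanSpace ℝ (Fin d) → ℂ :=
  𝓕⁻ (fun ξ => ((‖ξ‖ ^ s : ℝ) : ℂ) * 𝓕 f ξ)

/-- The Littlewood–Paley block `Δ_j f = φ(2^{−j}D) f`. -/
def lpBlock (φ : EuclideanSpace ℝ (Fin d) → ℝ) (j : ℤ)
    (f : EuclideanSpace ℝ (Fin d) → ℂ) : EuclideanSpace ℝ (Fin d) → ℂ :=
  𝓕⁻ (fun ξ => ((φ ((2:ℝ)^(-j) • ξ) : ℝ) : ℂ) * 𝓕 f ξ)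

/-- The homogeneous Besov norm `‖f‖_{Ḃ^σ_{p,r}} = ‖ (2^{jσ} ‖Δ_j f‖_{L^p})_{j∈ℤ} ‖_{ℓ^r}`
associated with the dyadic bump `φ`. -/
def besovNorm (φ : EuclideanSpace ℝ (Fin d) → ℝ) (σ : ℝ) (p r : ℝ≥0∞)
    (f : EuclideanSpace ℝ (Fin d) → ℂ) : ℝ≥0∞ :=
  if r = ⊤ then
    ⨆ j : ℤ, ENNReal.ofReal ((2:ℝ) ^ (σ * j)) * eLpNorm (lpBlock φ j f) p volume
  else
    (∑' j : ℤ, (ENNReal.ofReal ((2:ℝ) ^ (σ * j))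
      * eLpNorm (lpBlock φ j f) p volume) ^ r.toReal) ^ (1 / r.toReal)

/-- `φ` is a smooth dyadic bump: nonnegative, smooth, supported in the annulus
`{3/4 ≤ |ξ| ≤ 8/3}`, with `∑_{j∈ℤ} φ(2^{−j}ξ) = 1` for all `ξ ≠ 0`. -/
structure IsDyadicBump (φ : EuclideanSpace ℝ (Fin d) → ℝ) : Prop where
  smooth : ContDiff ℝ (⊤ : ℕ∞) φ
  nonneg : ∀ ξ, 0 ≤ φ ξ
  support : ∀ ξ, φ ξ ≠ 0 → (3/4 : ℝ) ≤ ‖ξ‖ ∧ ‖ξ‖ ≤ (8/3 : ℝ)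
  partition : ∀ ξ : EuclideanSpace ℝ (Fin d), ξ ≠ 0 →
    HasSum (fun j : ℤ => φ ((2:ℝ)^(-j) • ξ)) 1

open MeasureTheory Real FourierTransform ENNReal

/-- Minkowski-type inequality: averaging does not increase `L^p` norms. -/
lemma mink_aux {X Y : Type*} [MeasurableSpace X] [MeasurableSpace Y] (μ : Measure X)
    (ν : Measure Y) [SFinite μ] [SFinite ν] (F : Y → X → ℝ≥0∞)
    (hF : Measurable (Function.uncurry F)) (p : ℝ≥0∞) (hp : 1 ≤ p) (B : ℝ≥0∞)
    (hB : ∀ y, eLpNorm (F y) p μ ≤ B) :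
    eLpNorm (fun x => ∫⁻ y, F y x ∂ν) p μ ≤ ν Set.univ * B := by
  rcases eq_or_ne p ⊤ with rfl | hpt
  · simp only [eLpNorm_exponent_top] at hB ⊢
    have h1 : ∀ᵐ x ∂μ, ∀ᵐ y ∂ν, F y x ≤ B := by
      rw [Measure.ae_ae_comm]
      · filter_upwards with y
        filter_upwards [ae_le_eLpNormEssSup (f := F y) (μ := μ)] with x hx
        simpa using hx.trans (hB y)
      · exact measurableSet_le (by fun_prop) measurable_const
    refine eLpNormEssSup_le_of_ae_enorm_bound ?_
    filter_upwards [h1] with x hx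
    rw [enorm_eq_self]
    calc ∫⁻ y, F y x ∂ν ≤ ∫⁻ y, B ∂ν := lintegral_mono_ae hx
      _ = ν Set.univ * B := by simp [mul_comm]
  · have hp0 : p ≠ 0 := (zero_lt_one.trans_le hp).ne'
    have hq1 : 1 ≤ p.toReal := by
      rw [← ENNReal.toReal_one]; exact ENNReal.toReal_mono hpt hp
    set q := p.toReal with hq
    have hq0 : 0 < q := by linarith
    have key : ∀ x, (∫⁻ y, F y x ∂ν) ^ q ≤ ν Set.univ ^ (q - 1) * ∫⁻ y, F y x ^ q ∂ν := by
      intro x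
      have := eLpNorm'_le_eLpNorm'_mul_rpow_measure_univ (μ := ν) (f := fun y => F y x)
        (p := 1) (q := q) zero_lt_one hq1 (by
          have : Measurable fun y => F y x := by fun_prop
          exact this.aestronglyMeasurable)
      simp only [eLpNorm', enorm_eq_self, ENNReal.rpow_one, div_one] at this
      have h2 := ENNReal.rpow_le_rpow this hq0.le
      rw [ENNReal.mul_rpow_of_nonneg _ _ hq0.le, ← ENNReal.rpow_mul, ← ENNReal.rpow_mul,
        one_div_mul_cancel hq0.ne', ENNReal.rpow_one] at h2
      rw [mul_comm]
      convert h2 using 3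
      field_simp
    rw [eLpNorm_eq_lintegral_rpow_enorm_toReal hp0 hpt]
    simp only [enorm_eq_self, ← hq]
    have hBq : ∀ y, ∫⁻ x, F y x ^ q ∂μ ≤ B ^ q := by
      intro y
      have := hB y
      rw [eLpNorm_eq_lintegral_rpow_enorm_toReal hp0 hpt] at this
      simp only [enorm_eq_self, ← hq] at this
      have h2 := ENNReal.rpow_le_rpow this hq0.le
      rwa [← ENNReal.rpow_mul, one_div_mul_cancel hq0.ne', ENNReal.rpow_one] at h2
    have h3 : ∫⁻ x, (∫⁻ y, F y x ∂ν) ^ q ∂μ ≤ (ν Set.univ * B) ^ q := by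
      calc ∫⁻ x, (∫⁻ y, F y x ∂ν) ^ q ∂μ
          ≤ ∫⁻ x, ν Set.univ ^ (q - 1) * ∫⁻ y, F y x ^ q ∂ν ∂μ := lintegral_mono key
        _ = ν Set.univ ^ (q - 1) * ∫⁻ x, ∫⁻ y, F y x ^ q ∂ν ∂μ := by
            rw [lintegral_const_mul]
            apply Measurable.lintegral_prod_right'
              (f := fun z : X × Y => F z.2 z.1 ^ q)
            fun_prop
        _ = ν Set.univ ^ (q - 1) * ∫⁻ y, ∫⁻ x, F y x ^ q ∂μ ∂ν := by
            rw [lintegral_lintegral_swap]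
            have : Measurable fun z : X × Y => F z.2 z.1 ^ q := by fun_prop
            exact this.aemeasurable
        _ ≤ ν Set.univ ^ (q - 1) * ∫⁻ y, B ^ q ∂ν := by
            gcongr; exact hBq _
        _ = (ν Set.univ * B) ^ q := by
            rw [lintegral_const, ENNReal.mul_rpow_of_nonneg _ _ hq0.le, mul_comm (B ^ q),
              ← mul_assoc]
            congr 1
            nth_rewrite 2 [← ENNReal.rpow_one (ν Set.univ)]
            rw [← ENNReal.rpow_add_of_nonneg _ _ (by linarith) zero_le_one]
            simp
    calc (∫⁻ x, (∫⁻ y, F y x ∂ν) ^ q ∂μ) ^ (1 / q) ≤ ((ν Set.univ * B) ^ q) ^ (1 / q) :=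
          ENNReal.rpow_le_rpow h3 (by positivity)
      _ = _ := by rw [← ENNReal.rpow_mul, mul_one_div_cancel hq0.ne', ENNReal.rpow_one]

lemma mink {X Y : Type*} [MeasurableSpace X] [MeasurableSpace Y] (μ : Measure X)
    (ν : Measure Y) [SFinite μ] [SFinite ν] (k : Y → ℝ≥0∞) (hk : Measurable k) (F : Y → X → ℝ≥0∞)
    (hF : Measurable (Function.uncurry F)) (p : ℝ≥0∞) (hp : 1 ≤ p) (B : ℝ≥0∞)
    (hB : ∀ y, eLpNorm (F y) p μ ≤ B) :
    eLpNorm (fun x => ∫⁻ y, k y * F y x ∂ν) p μ ≤ (∫⁻ y, k y ∂ν) * B := by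
  have := mink_aux μ (ν.withDensity k) F hF p hp B hB
  rw [withDensity_apply _ MeasurableSet.univ, Measure.restrict_univ] at this
  convert this using 2
  ext x
  rw [lintegral_withDensity_eq_lintegral_mul _ hk (by fun_prop)]
  rfl

lemma eLpNorm_tsum_le' {X : Type*} [MeasurableSpace X] (μ : Measure X) [SFinite μ]
    (F : ℕ → X → ℝ≥0∞) (hF : ∀ n, Measurable (F n)) (p : ℝ≥0∞) (hp : 1 ≤ p) :
    eLpNorm (fun x => ∑' n, F n x) p μ ≤ ∑' n, eLpNorm (F n) p μ := by
  by_cases htop : ∑' n, eLpNorm (F n) p μ = ⊤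
  · simp [htop]
  refine ENNReal.le_of_forall_pos_le_add fun ε hε _ => ?_
  obtain ⟨e, he0, he⟩ := ENNReal.exists_pos_sum_of_countable (ε := (ε : ℝ≥0∞))
    (by exact_mod_cast hε.ne') ℕ
  set k : ℕ → ℝ≥0∞ := fun n => eLpNorm (F n) p μ + e n with hkdef
  have hk0 : ∀ n, k n ≠ 0 := fun n => by
    have : (e n : ℝ≥0∞) ≠ 0 := by exact_mod_cast (he0 n).ne'
    simp [hkdef, this]
  have hkt : ∀ n, k n ≠ ⊤ := fun n => by
    have := ENNReal.ne_top_of_tsum_ne_top htop n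
    simp [hkdef, this]
  have h := mink μ (Measure.count : Measure ℕ) k (measurable_of_countable _)
    (fun n x => (k n)⁻¹ * F n x) (by
      apply measurable_from_prod_countable_right
      intro n
      exact (hF n).const_mul (k n)⁻¹) p hp 1 (fun n => by
        have : eLpNorm (fun x => (k n)⁻¹ * F n x) p μ ≤ (k n)⁻¹ * eLpNorm (F n) p μ := by
          obtain ⟨c, hc⟩ : ∃ c : NNReal, (k n)⁻¹ = c :=
            ⟨(k n)⁻¹.toNNReal, by rw [ENNReal.coe_toNNReal]; simp [hk0]⟩
          rw [hc]
          refine (eLpNorm_le_nnreal_smul_eLpNorm_of_ae_le_mul' (c := c) (g := F n) ?_ p).trans ?_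
          · filter_upwards with x
            simp
          · simp [ENNReal.smul_def]
        refine this.trans ?_
        calc (k n)⁻¹ * eLpNorm (F n) p μ ≤ (k n)⁻¹ * k n := by gcongr; simp [hkdef]
          _ = 1 := ENNReal.inv_mul_cancel (hk0 n) (hkt n))
  simp only [lintegral_count, mul_one] at h
  have h4 : (fun x => ∑' n, k n * ((k n)⁻¹ * F n x)) = fun x => ∑' n, F n x := by
    ext x; congr 1; ext n
    rw [← mul_assoc, ENNReal.mul_inv_cancel (hk0 n) (hkt n), one_mul]
  rw [h4] at h
  refine h.trans ?_
  rw [hkdef, ENNReal.tsum_add]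
  gcongr

open MeasureTheory Real FourierTransform ENNReal

/-- The standard character `t ↦ e^{2πit}`. -/
noncomputable def ch (t : ℝ) : ℂ := (Real.fourierChar t : ℂ)

lemma ch_add (a b : ℝ) : ch (a + b) = ch a * ch b := by
  simp [ch, AddChar.map_add_eq_mul]

lemma norm_ch (a : ℝ) : ‖ch a‖ = 1 := by
  unfold ch; exact Circle.norm_coe _

@[fun_prop]
lemma continuous_ch : Continuous ch := by
  unfold ch
  have := Real.continuous_fourierChar
  exact continuous_subtype_val.comp this

section general
set_option linter.unusedSectionVars false
variable {V : Type*} [NormedAddCommGroup V] [InnerProductSpace ℝ V] [FiniteDimensional ℝ V]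
  [MeasurableSpace V] [BorelSpace V]

lemma fInv_eq (a : V → ℂ) (x : V) : 𝓕⁻ a x = ∫ ξ, ch (inner ℝ ξ x) * a ξ := by
  rw [Real.fourierInv_eq]; rfl

lemma fF_eq (a : V → ℂ) (x : V) : 𝓕 a x = ∫ ξ, ch (- inner ℝ ξ x) * a ξ := by
  rw [Real.fourier_eq]; rfl

/-- Oscillatory integral with phase `h` and amplitude `W`. -/
noncomputable def PH {Z : Type*} [MeasurableSpace Z] (ν : Measure Z) (h : Z → V) (W : Z → ℂ)
    (x : V) : ℂ := ∫ z, ch (inner ℝ (h z) x) * W z ∂ν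

lemma PH_integrable {Z : Type*} [MeasurableSpace Z] {ν : Measure Z} {h : Z → V}
    (hh : Measurable h) {W : Z → ℂ} (hW : Integrable W ν) (x : V) :
    Integrable (fun z => ch (inner ℝ (h z) x) * W z) ν := by
  refine hW.mono ?_ ?_
  · refine AEStronglyMeasurable.mul ?_ hW.1
    exact (continuous_ch.measurable.comp (hh.inner_const)).aestronglyMeasurable
  · filter_upwards with z
    simp [norm_ch]

lemma PH_continuous {Z : Type*} [MeasurableSpace Z] {ν : Measure Z} {h : Z → V}
    (hh : Measurable h) {W : Z → ℂ} (hW : Integrable W ν) : Continuous (PH ν h W) := by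
  unfold PH
  refine continuous_of_dominated (bound := fun z => ‖W z‖) ?_ ?_ hW.norm ?_
  · intro x; exact (PH_integrable hh hW x).1
  · intro x; filter_upwards with z; simp [norm_ch]
  · filter_upwards with z; fun_prop

lemma PH_add {Z : Type*} [MeasurableSpace Z] {ν : Measure Z} {h : Z → V}
    (hh : Measurable h) {W W' : Z → ℂ} (hW : Integrable W ν) (hW' : Integrable W' ν) (x : V) :
    PH ν h (fun z => W z + W' z) x = PH ν h W x + PH ν h W' x := by
  unfold PH
  rw [← integral_add (PH_integrable hh hW x) (PH_integrable hh hW' x)]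
  simp only [mul_add]

lemma PH_sub {Z : Type*} [MeasurableSpace Z] {ν : Measure Z} {h : Z → V}
    (hh : Measurable h) {W W' : Z → ℂ} (hW : Integrable W ν) (hW' : Integrable W' ν) (x : V) :
    PH ν h (fun z => W z - W' z) x = PH ν h W x - PH ν h W' x := by
  unfold PH
  rw [← integral_sub (PH_integrable hh hW x) (PH_integrable hh hW' x)]
  simp only [mul_sub]

lemma PH_sum {Z : Type*} [MeasurableSpace Z] {ν : Measure Z} {h : Z → V}
    (hh : Measurable h) {ι : Type*} (s : Finset ι) {W : ι → Z → ℂ}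
    (hW : ∀ i ∈ s, Integrable (W i) ν) (x : V) :
    PH ν h (fun z => ∑ i ∈ s, W i z) x = ∑ i ∈ s, PH ν h (W i) x := by
  unfold PH
  rw [← integral_finsetSum _ (fun i hi => PH_integrable hh (hW i hi) x)]
  simp only [Finset.mul_sum]

lemma PH_const_mul {Z : Type*} [MeasurableSpace Z] {ν : Measure Z} {h : Z → V}
    {W : Z → ℂ} (c : ℂ) (x : V) :
    PH ν h (fun z => c * W z) x = c * PH ν h W x := by
  unfold PH
  rw [← integral_const_mul]
  congr 1; ext z; ring

/-- Infinite sums of amplitudes, dominated. -/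
lemma PH_hasSum {Z : Type*} [MeasurableSpace Z] {ν : Measure Z} {h : Z → V}
    (hh : Measurable h) {W : ℕ → Z → ℂ} {W₀ : Z → ℂ}
    (hW : ∀ n, AEStronglyMeasurable (W n) ν) (c : ℕ → Z → ℝ) (B : Z → ℝ) (hB : Integrable B ν)
    (hcs : ∀ z, HasSum (fun n => c n z) (B z))
    (hWc : ∀ n z, ‖W n z‖ ≤ c n z) (hsum : ∀ z, HasSum (fun n => W n z) (W₀ z)) (x : V) :
    HasSum (fun n => PH ν h (W n) x) (PH ν h W₀ x) := by
  unfold PH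
  refine hasSum_integral_of_dominated_convergence c ?_ ?_ ?_ ?_ ?_
  · intro n
    refine AEStronglyMeasurable.mul ?_ (hW n)
    exact (continuous_ch.measurable.comp (hh.inner_const)).aestronglyMeasurable
  · intro n; filter_upwards with z
    simpa [norm_ch] using hWc n z
  · filter_upwards with z; exact (hcs z).summable
  · convert hB using 1
    ext z; exact (hcs z).tsum_eq
  · filter_upwards with z
    exact (hsum z).mul_left _

lemma fInv_eq_PH (a : V → ℂ) : 𝓕⁻ a = PH volume id a := by
  ext x; rw [fInv_eq]; rfl

lemma fInv_continuous {a : V → ℂ} (ha : Integrable a) : Continuous (𝓕⁻ a) := by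
  rw [fInv_eq_PH]; exact PH_continuous measurable_id ha

lemma conv_swap {Z : Type*} [MeasurableSpace Z] {ν : Measure Z} [SFinite ν] {h : Z → V}
    (hh : Measurable h) {W : Z → ℂ} (hW : Integrable W ν) {K : V → ℂ} (hK : Integrable K)
    (t : ℝ) (x : V) :
    ∫ y, K y * PH ν h W (x - t • y) = PH ν h (fun z => 𝓕 K (t • h z) * W z) x := by
  unfold PH
  have e1 : ∀ y, K y * ∫ z, ch (inner ℝ (h z) (x - t • y)) * W z ∂ν
      = ∫ z, K y * (ch (inner ℝ (h z) (x - t • y)) * W z) ∂ν := fun y => by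
    rw [integral_const_mul]
  simp only [e1]
  rw [integral_integral_swap]
  · congr 1; ext z
    rw [fF_eq, ← integral_mul_const, ← integral_const_mul]
    congr 1; ext y
    rw [show inner ℝ (h z) (x - t • y) = inner ℝ (h z) x + - inner ℝ y (t • h z) by
      rw [inner_sub_right, inner_smul_right, inner_smul_right, real_inner_comm y (h z)]; ring, ch_add]
    ring
  · have := hK.mul_prod hW
    refine this.mono ?_ ?_
    · have hm : Measurable (fun q : V × Z => ch (inner ℝ (h q.2) (x - t • q.1))) := by
        refine continuous_ch.measurable.comp ?_
        refine Measurable.inner (hh.comp measurable_snd) ?_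
        fun_prop
      have := hm.aestronglyMeasurable.mul this.1
      refine this.congr ?_
      filter_upwards with q
      simp [Function.uncurry]; ring
    · filter_upwards with q
      simp [Function.uncurry, norm_ch]

/-- Multiplier acting on an inverse Fourier transform. -/
lemma conv_fInv {a : V → ℂ} (ha : Integrable a) {K : V → ℂ} (hK : Integrable K) (t : ℝ) (x : V) :
    ∫ y, K y * 𝓕⁻ a (x - t • y) = 𝓕⁻ (fun ξ => 𝓕 K (t • ξ) * a ξ) x := by
  rw [fInv_eq_PH, fInv_eq_PH, conv_swap measurable_id ha hK]
  rfl

/-- `L1`: physical-space form of a multiplier applied to an integrable function. -/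
lemma mult_eq_conv {R m : V → ℂ} (hR : Integrable R) (hm : Integrable m) (x : V) :
    𝓕⁻ (fun ξ => m ξ * 𝓕 R ξ) x = ∫ y, 𝓕⁻ m y * R (x - y) := by
  have := conv_fInv hm hR 1 x
  simp only [one_smul] at this
  have h2 := integral_sub_left_eq_self (fun y => 𝓕⁻ m y * R (x - y)) volume x
  refine Eq.trans ?_ h2
  rw [show (fun ξ => m ξ * 𝓕 R ξ) = fun ξ => 𝓕 R ξ * m ξ by ext; ring, ← this]
  congr 1; ext y
  rw [_root_.sub_sub_cancel, mul_comm]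

/-- Bilinear oscillatory integral. -/
noncomputable def BT (W : V × V → ℂ) : V → ℂ :=
  PH ((volume : Measure V).prod (volume : Measure V)) (fun z => z.1 + z.2) W

lemma BT_prod (a b : V → ℂ) (x : V) :
    BT (fun z => a z.1 * b z.2) x = 𝓕⁻ a x * 𝓕⁻ b x := by
  rw [fInv_eq, fInv_eq, ← integral_prod_mul]
  unfold BT PH
  congr 1; ext z
  rw [inner_add_left, ch_add]; ring

lemma conv_BT {a b : V → ℂ} (ha : Integrable a) (hb : Integrable b) {K : V → ℂ}
    (hK : Integrable K) (t : ℝ) (x : V) :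
    ∫ y, K y * (𝓕⁻ a (x - t • y) * 𝓕⁻ b (x - t • y)) =
      BT (fun z => 𝓕 K (t • (z.1 + z.2)) * (a z.1 * b z.2)) x := by
  have := conv_swap (ν := (volume : Measure V).prod (volume : Measure V))
    (h := fun z => z.1 + z.2) (by fun_prop) (ha.mul_prod hb) hK t x
  rw [BT, ← this]
  congr 1; ext y
  rw [← BT_prod]; rfl

/-- Convolution-type bound in `L^p`. -/
lemma conv_bound (p : ℝ≥0∞) (hp : 1 ≤ p) (k : V → ℝ≥0∞) (hk : Measurable k) (t : ℝ)
    (u v : V → ℂ) (hu : Continuous u) (huv : ∀ x, ‖v x‖ₑ ≤ ∫⁻ y, k y * ‖u (x - t • y)‖ₑ) :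
    eLpNorm v p volume ≤ (∫⁻ y, k y) * eLpNorm u p volume := by
  have h1 : eLpNorm v p volume ≤ eLpNorm (fun x => ∫⁻ y, k y * ‖u (x - t • y)‖ₑ) p volume := by
    apply eLpNorm_mono_enorm
    intro x; simpa using huv x
  refine h1.trans ?_
  refine mink volume volume k hk (fun y x => ‖u (x - t • y)‖ₑ) ?_ p hp _ ?_
  · have : Continuous fun q : V × V => u (q.2 - t • q.1) := by fun_prop
    exact this.measurable.enorm
  · intro y
    rw [eLpNorm_enorm]
    have : MeasurePreserving (fun x : V => x - t • y) volume volume :=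
      measurePreserving_sub_right volume _
    exact (eLpNorm_comp_measurePreserving (μ := volume) (ν := volume) hu.aestronglyMeasurable this).le

lemma enorm_int_mul_le (K : V → ℂ) (w : V → ℂ) (c : V → ℝ≥0∞) (hc : ∀ y, ‖w y‖ₑ ≤ c y) :
    ‖∫ y, K y * w y‖ₑ ≤ ∫⁻ y, ‖K y‖ₑ * c y := by
  refine (enorm_integral_le_lintegral_enorm _).trans (lintegral_mono fun y => ?_)
  rw [enorm_mul]; gcongr; exact hc y

lemma lint_enorm {K : V → ℂ} (hK : Integrable K) : ∫⁻ y, ‖K y‖ₑ = ENNReal.ofReal (∫ y, ‖K y‖) :=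
  (ofReal_integral_norm_eq_lintegral_enorm hK).symm

/-- `L¹` norm of a kernel. -/
noncomputable def N0 (K : SchwartzMap V ℂ) : ℝ := ∫ y, ‖K y‖

/-- First moment of a kernel. -/
noncomputable def N1 (K : SchwartzMap V ℂ) : ℝ := ∫ y, ‖y‖ * ‖K y‖

lemma N0_nonneg (K : SchwartzMap V ℂ) : 0 ≤ N0 K := integral_nonneg fun _ => norm_nonneg _
lemma N1_nonneg (K : SchwartzMap V ℂ) : 0 ≤ N1 K := integral_nonneg fun _ => by positivity

lemma E0 (K : SchwartzMap V ℂ) (t : ℝ) {a : V → ℂ} (ha : Integrable a)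
    (p : ℝ≥0∞) (hp : 1 ≤ p) :
    eLpNorm (𝓕⁻ (fun ξ => 𝓕 (K : V → ℂ) (t • ξ) * a ξ)) p volume ≤
      ENNReal.ofReal (N0 K) * eLpNorm (𝓕⁻ a) p volume := by
  rw [N0, ← lint_enorm K.integrable]
  refine conv_bound p hp _ K.continuous.measurable.enorm t _ _ (fInv_continuous ha) fun x => ?_
  rw [← conv_fInv ha K.integrable]
  exact enorm_int_mul_le _ _ _ fun y => le_rfl

lemma E0sup (K : SchwartzMap V ℂ) (t : ℝ) {a : V → ℂ} (ha : Integrable a)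
    (A : ℝ) (hA : ∀ x, ‖𝓕⁻ a x‖ ≤ A) (x : V) :
    ‖𝓕⁻ (fun ξ => 𝓕 (K : V → ℂ) (t • ξ) * a ξ) x‖ ≤ N0 K * A := by
  rw [← conv_fInv ha K.integrable, N0, ← integral_mul_const]
  refine norm_integral_le_of_norm_le (K.integrable.norm.mul_const _) ?_
  filter_upwards with y
  rw [norm_mul]; gcongr; exact hA _

lemma E0lip (K : SchwartzMap V ℂ) (t : ℝ) {a : V → ℂ} (ha : Integrable a)
    (A : ℝ) (hA : ∀ x y, ‖𝓕⁻ a x - 𝓕⁻ a y‖ ≤ A * ‖x - y‖) (x y : V) :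
    ‖𝓕⁻ (fun ξ => 𝓕 (K : V → ℂ) (t • ξ) * a ξ) x - 𝓕⁻ (fun ξ => 𝓕 (K : V → ℂ) (t • ξ) * a ξ) y‖
      ≤ (N0 K * A) * ‖x - y‖ := by
  have hi : ∀ x, Integrable fun y => K y * 𝓕⁻ a (x - t • y) := by
    intro x
    have hc := fInv_continuous ha
    refine (K.integrable.norm.mul_const (∫ ξ, ‖a ξ‖)).mono' ?_ ?_
    · refine Continuous.aestronglyMeasurable ?_
      have := K.continuous
      fun_prop
    · filter_upwards with y
      rw [norm_mul]; gcongr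
      rw [fInv_eq]
      refine norm_integral_le_of_norm_le ha.norm ?_
      filter_upwards with z; simp [norm_ch]
  rw [← conv_fInv ha K.integrable, ← conv_fInv ha K.integrable, ← integral_sub (hi x) (hi y), N0,
    mul_assoc, ← integral_mul_const]
  refine norm_integral_le_of_norm_le (K.integrable.norm.mul_const _) ?_
  filter_upwards with z
  rw [← mul_sub, norm_mul]; gcongr
  refine (hA _ _).trans_eq ?_
  congr 2; abel

lemma E1 (K : SchwartzMap V ℂ) (t : ℝ) {a b : V → ℂ} (ha : Integrable a) (hb : Integrable b)
    (p : ℝ≥0∞) (hp : 1 ≤ p) (A : ℝ) (hA : ∀ x, ‖𝓕⁻ b x‖ ≤ A) :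
    eLpNorm (BT (fun z => 𝓕 (K : V → ℂ) (t • (z.1 + z.2)) * (a z.1 * b z.2))) p volume ≤
      ENNReal.ofReal (N0 K * A) * eLpNorm (𝓕⁻ a) p volume := by
  have := conv_bound p hp (fun y => ‖K y‖ₑ * ENNReal.ofReal A)
    (K.continuous.measurable.enorm.mul_const _) t (𝓕⁻ a)
    (BT (fun z => 𝓕 (K : V → ℂ) (t • (z.1 + z.2)) * (a z.1 * b z.2))) (fInv_continuous ha)
    fun x => by
      rw [← conv_BT ha hb K.integrable]
      refine (enorm_int_mul_le _ _ (fun y => ENNReal.ofReal A * ‖𝓕⁻ a (x - t • y)‖ₑ) fun y => ?_).trans_eq ?_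
      · rw [enorm_mul, mul_comm]; gcongr
        rw [← ofReal_norm]; exact ENNReal.ofReal_le_ofReal (hA _)
      · simp only [mul_assoc]
  refine this.trans_eq ?_
  rw [lintegral_mul_const _ K.continuous.measurable.enorm, lint_enorm K.integrable,
    ENNReal.ofReal_mul (N0_nonneg K)]; rfl

lemma fInv_bdd {a : V → ℂ} (ha : Integrable a) (x : V) : ‖𝓕⁻ a x‖ ≤ ∫ ξ, ‖a ξ‖ := by
  rw [fInv_eq]
  refine norm_integral_le_of_norm_le ha.norm ?_
  filter_upwards with z; simp [norm_ch]

lemma fF_bdd {a : V → ℂ} (ha : Integrable a) (x : V) : ‖𝓕 a x‖ ≤ ∫ ξ, ‖a ξ‖ := by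
  rw [fF_eq]
  refine norm_integral_le_of_norm_le ha.norm ?_
  filter_upwards with z; simp [norm_ch]

lemma E2_key (K : SchwartzMap V ℂ) (t : ℝ) {a b : V → ℂ} (ha : Integrable a) (hb : Integrable b)
    (x : V) :
    BT (fun z => (𝓕 (K : V → ℂ) (t • (z.1 + z.2)) - 𝓕 (K : V → ℂ) (t • z.2)) *
        (a z.1 * b z.2)) x
      = ∫ y, K y * ((𝓕⁻ a (x - t • y) - 𝓕⁻ a x) * 𝓕⁻ b (x - t • y)) := by
  have hFc : Continuous (𝓕 (K : V → ℂ)) := (𝓕 K).continuous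
  have hM := fF_bdd K.integrable
  have hac := fInv_continuous ha
  have hbc := fInv_continuous hb
  have hKc := K.continuous
  have e3 := BT_prod a (fun ξ => 𝓕 (K : V → ℂ) (t • ξ) * b ξ) x
  have e4 := conv_BT ha hb K.integrable t x
  have e5 := conv_fInv hb K.integrable t x
  generalize 𝓕 (K : V → ℂ) = FK at *
  generalize (∫ ξ, ‖K ξ‖) = M at *
  have i1 : Integrable (fun z : V × V => FK (t • (z.1 + z.2)) * (a z.1 * b z.2))
      (volume.prod volume) := (ha.mul_prod hb).bdd_mul (c := M)
        (Continuous.aestronglyMeasurable (by fun_prop)) (by filter_upwards with z; exact hM _)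
  have i2 : Integrable (fun z : V × V => a z.1 * (FK (t • z.2) * b z.2))
      (volume.prod volume) := ha.mul_prod (hb.bdd_mul (c := M) (f := fun z => FK (t • z))
        (Continuous.aestronglyMeasurable (by fun_prop)) (by filter_upwards with z; exact hM _))
  have e1 : (fun z : V × V => (FK (t • (z.1 + z.2)) - FK (t • z.2)) *
        (a z.1 * b z.2)) = fun z => FK (t • (z.1 + z.2)) * (a z.1 * b z.2)
          - a z.1 * (FK (t • z.2) * b z.2) := by ext z; ring
  have e2 := PH_sub (h := fun z : V × V => z.1 + z.2) (by fun_prop) i1 i2 x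
  rw [e1]
  unfold BT at e3 e4 ⊢
  have hA := fInv_bdd ha
  have hB := fInv_bdd hb
  rw [e2, e3, ← e4, ← e5]
  generalize 𝓕⁻ a = u at *
  generalize 𝓕⁻ b = v at *
  generalize (∫ ξ, ‖a ξ‖) = A at *
  generalize (∫ ξ, ‖b ξ‖) = B at *
  have hA0 : 0 ≤ A := (norm_nonneg _).trans (hA 0)
  have hB0 : 0 ≤ B := (norm_nonneg _).trans (hB 0)
  rw [← integral_const_mul, ← integral_sub]
  · congr 1; ext y; ring
  · refine (K.integrable.norm.mul_const (A * B)).mono' ?_ ?_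
    · exact Continuous.aestronglyMeasurable (by fun_prop)
    · filter_upwards with y
      rw [norm_mul, norm_mul]; gcongr
      · exact hA _
      · exact hB _
  · refine Integrable.const_mul ?_ _
    refine (K.integrable.norm.mul_const B).mono' ?_ ?_
    · exact Continuous.aestronglyMeasurable (by fun_prop)
    · filter_upwards with y
      rw [norm_mul]; gcongr
      exact hB _

lemma E2_bound (K : SchwartzMap V ℂ) (t : ℝ) (u v w : V → ℂ) (hv : Continuous v)
    (p : ℝ≥0∞) (hp : 1 ≤ p) (ht : 0 ≤ t) (U : ℝ) (hU0 : 0 ≤ U)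
    (hU : ∀ x y, ‖u x - u y‖ ≤ U * ‖x - y‖)
    (hw : ∀ x, w x = ∫ y, K y * ((u (x - t • y) - u x) * v (x - t • y))) :
    eLpNorm w p volume ≤ ENNReal.ofReal (t * N1 K * U) * eLpNorm v p volume := by
  have hKc := K.continuous
  have hKm : Measurable fun y : V => ENNReal.ofReal (‖y‖ * ‖K y‖) := by fun_prop
  have := conv_bound p hp (fun y => ENNReal.ofReal (t * U) * ENNReal.ofReal (‖y‖ * ‖K y‖))
    (hKm.const_mul _) t v w hv
    fun x => by
      rw [hw]
      refine (enorm_int_mul_le _ _ (fun y => ENNReal.ofReal (t * U) * ENNReal.ofReal ‖y‖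
        * ‖v (x - t • y)‖ₑ) fun y => ?_).trans_eq ?_
      · rw [enorm_mul]; gcongr
        rw [← ofReal_norm, ← ENNReal.ofReal_mul (by positivity)]
        apply ENNReal.ofReal_le_ofReal
        refine (hU _ _).trans_eq ?_
        rw [sub_sub_cancel_left, norm_neg, norm_smul, Real.norm_of_nonneg ht]; ring
      · congr 1; ext y
        rw [ENNReal.ofReal_mul (norm_nonneg y), ofReal_norm (K y)]; ring
  refine this.trans_eq ?_
  rw [lintegral_const_mul _ hKm, ← ofReal_integral_eq_lintegral_ofReal,
    ← ENNReal.ofReal_mul (by positivity)]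
  · congr 2; rw [N1]; ring
  · simpa using K.integrable_pow_mul volume 1
  · filter_upwards with y; positivity

lemma E2 (K : SchwartzMap V ℂ) (t : ℝ) {a b : V → ℂ} (ha : Integrable a) (hb : Integrable b)
    (p : ℝ≥0∞) (hp : 1 ≤ p) (ht : 0 ≤ t) (U : ℝ) (hU0 : 0 ≤ U)
    (hU : ∀ x y, ‖𝓕⁻ a x - 𝓕⁻ a y‖ ≤ U * ‖x - y‖) :
    eLpNorm (BT (fun z => (𝓕 (K : V → ℂ) (t • (z.1 + z.2)) - 𝓕 (K : V → ℂ) (t • z.2)) *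
        (a z.1 * b z.2))) p volume ≤
      ENNReal.ofReal (t * N1 K * U) * eLpNorm (𝓕⁻ b) p volume :=
  E2_bound K t (𝓕⁻ a) (𝓕⁻ b) _ (fInv_continuous hb) p hp ht U hU0 hU (E2_key K t ha hb)

end general

open MeasureTheory Real FourierTransform ENNReal
open scoped ContDiff

/-- `M` is the Fourier transform of a Schwartz kernel with mass and first moment at most `C`. -/
def IsMul {d : ℕ} (M : EuclideanSpace ℝ (Fin d) → ℂ) (C : ℝ) : Prop :=
  ∃ K : SchwartzMap (EuclideanSpace ℝ (Fin d)) ℂ,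
    𝓕 (K : EuclideanSpace ℝ (Fin d) → ℂ) = M ∧ N0 K ≤ C ∧ N1 K ≤ C

section mult
variable {d : ℕ}

lemma exists_isMul {M : EuclideanSpace ℝ (Fin d) → ℂ} (h1 : ContDiff ℝ ∞ M)
    (h2 : HasCompactSupport M) : ∃ C, 0 ≤ C ∧ IsMul M C := by
  set S : SchwartzMap (EuclideanSpace ℝ (Fin d)) ℂ := h2.toSchwartzMap h1 with hS
  refine ⟨max (N0 (𝓕⁻ S)) (N1 (𝓕⁻ S)), le_max_of_le_left (N0_nonneg _), 𝓕⁻ S, ?_,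
    le_max_left _ _, le_max_right _ _⟩
  rw [← SchwartzMap.fourier_coe, FourierTransform.fourier_fourierInv_eq]
  rfl

lemma IsMul.mono {M : EuclideanSpace ℝ (Fin d) → ℂ} {C C' : ℝ} (h : IsMul M C) (hC : C ≤ C') :
    IsMul M C' := by
  obtain ⟨K, hK, h0, h1⟩ := h
  exact ⟨K, hK, h0.trans hC, h1.trans hC⟩

lemma IsMul.bdd {M : EuclideanSpace ℝ (Fin d) → ℂ} {C : ℝ} (h : IsMul M C) (ξ) : ‖M ξ‖ ≤ C := by
  obtain ⟨K, rfl, h0, h1⟩ := h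
  exact (fF_bdd K.integrable ξ).trans h0

lemma IsMul.continuous {M : EuclideanSpace ℝ (Fin d) → ℂ} {C : ℝ} (h : IsMul M C) :
    Continuous M := by
  obtain ⟨K, rfl, h0, h1⟩ := h
  rw [← SchwartzMap.fourier_coe]
  exact SchwartzMap.continuous _

lemma IsMul.nonneg {M : EuclideanSpace ℝ (Fin d) → ℂ} {C : ℝ} (h : IsMul M C) : 0 ≤ C :=
  (norm_nonneg _).trans (h.bdd 0)

lemma IsMul.integrable_mul {M : EuclideanSpace ℝ (Fin d) → ℂ} {C : ℝ} (h : IsMul M C) (t : ℝ)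
    {a : EuclideanSpace ℝ (Fin d) → ℂ} (ha : Integrable a) :
    Integrable (fun ξ => M (t • ξ) * a ξ) := by
  refine ha.bdd_mul (c := C) ?_ ?_
  · exact (h.continuous.comp (by fun_prop)).aestronglyMeasurable
  · filter_upwards with x using h.bdd _

lemma IsMul.E0 {M : EuclideanSpace ℝ (Fin d) → ℂ} {C : ℝ} (h : IsMul M C) (t : ℝ)
    {a : EuclideanSpace ℝ (Fin d) → ℂ} (ha : Integrable a) (p : ℝ≥0∞) (hp : 1 ≤ p) :
    eLpNorm (𝓕⁻ (fun ξ => M (t • ξ) * a ξ)) p volume ≤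
      ENNReal.ofReal C * eLpNorm (𝓕⁻ a) p volume := by
  obtain ⟨K, rfl, h0, h1⟩ := h
  refine (_root_.E0 K t ha p hp).trans ?_
  gcongr

lemma IsMul.E0sup {M : EuclideanSpace ℝ (Fin d) → ℂ} {C : ℝ} (h : IsMul M C) (t : ℝ)
    {a : EuclideanSpace ℝ (Fin d) → ℂ} (ha : Integrable a)
    (A : ℝ) (hA : ∀ x, ‖𝓕⁻ a x‖ ≤ A) (x : EuclideanSpace ℝ (Fin d)) :
    ‖𝓕⁻ (fun ξ => M (t • ξ) * a ξ) x‖ ≤ C * A := by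
  obtain ⟨K, rfl, h0, h1⟩ := h
  refine (_root_.E0sup K t ha A hA x).trans ?_
  have : 0 ≤ A := (norm_nonneg _).trans (hA 0)
  gcongr

lemma IsMul.E0lip {M : EuclideanSpace ℝ (Fin d) → ℂ} {C : ℝ} (h : IsMul M C) (t : ℝ)
    {a : EuclideanSpace ℝ (Fin d) → ℂ} (ha : Integrable a)
    (A : ℝ) (hA0 : 0 ≤ A) (hA : ∀ x y, ‖𝓕⁻ a x - 𝓕⁻ a y‖ ≤ A * ‖x - y‖)
    (x y : EuclideanSpace ℝ (Fin d)) :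
    ‖𝓕⁻ (fun ξ => M (t • ξ) * a ξ) x - 𝓕⁻ (fun ξ => M (t • ξ) * a ξ) y‖ ≤ (C * A) * ‖x - y‖ := by
  obtain ⟨K, rfl, h0, h1⟩ := h
  refine (_root_.E0lip K t ha A hA x y).trans ?_
  gcongr

lemma IsMul.E1 {M : EuclideanSpace ℝ (Fin d) → ℂ} {C : ℝ} (h : IsMul M C) (t : ℝ)
    {a b : EuclideanSpace ℝ (Fin d) → ℂ} (ha : Integrable a) (hb : Integrable b)
    (p : ℝ≥0∞) (hp : 1 ≤ p) (A : ℝ) (hA : ∀ x, ‖𝓕⁻ b x‖ ≤ A) :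
    eLpNorm (BT (fun z => M (t • (z.1 + z.2)) * (a z.1 * b z.2))) p volume ≤
      ENNReal.ofReal (C * A) * eLpNorm (𝓕⁻ a) p volume := by
  obtain ⟨K, rfl, h0, h1⟩ := h
  refine (_root_.E1 K t ha hb p hp A hA).trans ?_
  have : 0 ≤ A := (norm_nonneg _).trans (hA 0)
  gcongr

lemma IsMul.E2 {M : EuclideanSpace ℝ (Fin d) → ℂ} {C : ℝ} (h : IsMul M C) (t : ℝ)
    {a b : EuclideanSpace ℝ (Fin d) → ℂ} (ha : Integrable a) (hb : Integrable b)
    (p : ℝ≥0∞) (hp : 1 ≤ p) (ht : 0 ≤ t) (U : ℝ) (hU0 : 0 ≤ U)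
    (hU : ∀ x y, ‖𝓕⁻ a x - 𝓕⁻ a y‖ ≤ U * ‖x - y‖) :
    eLpNorm (BT (fun z => (M (t • (z.1 + z.2)) - M (t • z.2)) * (a z.1 * b z.2))) p volume ≤
      ENNReal.ofReal (t * C * U) * eLpNorm (𝓕⁻ b) p volume := by
  obtain ⟨K, rfl, h0, h1⟩ := h
  refine (_root_.E2 K t ha hb p hp ht U hU0 hU).trans ?_
  gcongr

/-- Smooth annular cutoffs. -/
structure Ann (θ : EuclideanSpace ℝ (Fin d) → ℝ) : Prop where
  smooth : ContDiff ℝ ∞ θ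
  supp : ∃ ε R : ℝ, 0 < ε ∧ ∀ ξ, θ ξ ≠ 0 → ε ≤ ‖ξ‖ ∧ ‖ξ‖ ≤ R

/-- The symbol `θ(ξ) |ξ|^b P(ξ)`. -/
noncomputable def mu (θ : EuclideanSpace ℝ (Fin d) → ℝ) (b : ℝ) (P : EuclideanSpace ℝ (Fin d) → ℝ)
    (ξ : EuclideanSpace ℝ (Fin d)) : ℂ := ((θ ξ * ‖ξ‖ ^ b * P ξ : ℝ) : ℂ)

lemma Ann.isMul {θ : EuclideanSpace ℝ (Fin d) → ℝ} (hθ : Ann θ) (b : ℝ)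
    {P : EuclideanSpace ℝ (Fin d) → ℝ} (hP : ContDiff ℝ ∞ P) :
    ∃ C, 0 ≤ C ∧ IsMul (mu θ b P) C := by
  obtain ⟨ε, R, hε, hs⟩ := hθ.supp
  apply exists_isMul
  · refine Complex.ofRealCLM.contDiff.comp (f := fun ξ => θ ξ * ‖ξ‖ ^ b * P ξ) ?_
    rw [contDiff_iff_contDiffAt]
    intro ξ
    by_cases h : ξ = 0
    · have : (fun ξ => θ ξ * ‖ξ‖ ^ b * P ξ) =ᶠ[nhds ξ] fun _ => 0 := by
        rw [h]
        filter_upwards [Metric.ball_mem_nhds 0 hε] with η hη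
        have : θ η = 0 := by
          by_contra h'
          have := (hs η h').1
          simp at hη
          linarith
        simp [this]
      exact contDiffAt_const.congr_of_eventuallyEq this
    · refine (hθ.smooth.contDiffAt.mul ?_).mul hP.contDiffAt
      exact (contDiffAt_norm ℝ h).rpow_const_of_ne (by simpa using h)
  · refine HasCompactSupport.intro (isCompact_closedBall 0 R) ?_
    intro ξ hξ
    have : θ ξ = 0 := by
      by_contra h'
      have := (hs ξ h').2
      simp at hξ
      linarith
    simp [mu, this]

lemma mu_zero_one (θ : EuclideanSpace ℝ (Fin d) → ℝ) (ξ) :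
    mu θ 0 (fun _ => 1) ξ = (θ ξ : ℂ) := by simp [mu]

lemma contDiff_coord (i : Fin d) : ContDiff ℝ ∞ (fun ξ : EuclideanSpace ℝ (Fin d) => ξ i) := by
  fun_prop

end mult

open MeasureTheory Real FourierTransform ENNReal
open scoped ContDiff

section bump
variable {d : ℕ} {φ : EuclideanSpace ℝ (Fin d) → ℝ}

lemma norm_sc (j : ℤ) (ξ : EuclideanSpace ℝ (Fin d)) :
    ‖(2:ℝ) ^ (-j) • ξ‖ = (2:ℝ) ^ (-j) * ‖ξ‖ := by
  rw [norm_smul, Real.norm_of_nonneg (by positivity)]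

lemma phi_ann (hφ : IsDyadicBump φ) : Ann φ where
  smooth := hφ.smooth
  supp := ⟨3/4, 8/3, by norm_num, hφ.support⟩

lemma phi_supp (hφ : IsDyadicBump φ) {j : ℤ} {ξ : EuclideanSpace ℝ (Fin d)}
    (h : φ ((2:ℝ) ^ (-j) • ξ) ≠ 0) : 3/4 * (2:ℝ) ^ j ≤ ‖ξ‖ ∧ ‖ξ‖ ≤ 8/3 * (2:ℝ) ^ j := by
  have := hφ.support _ h
  rw [norm_sc, zpow_neg] at this
  have h2 : (0:ℝ) < (2:ℝ) ^ j := by positivity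
  constructor
  · have := mul_le_mul_of_nonneg_right this.1 h2.le
    rwa [mul_right_comm, inv_mul_cancel₀ h2.ne', one_mul] at this
  · have := mul_le_mul_of_nonneg_right this.2 h2.le
    rwa [mul_right_comm, inv_mul_cancel₀ h2.ne', one_mul] at this

lemma phi_zero (hφ : IsDyadicBump φ) : φ 0 = 0 := by
  by_contra h
  have := (hφ.support _ h).1
  simp at this
  linarith

lemma phi_le_one (hφ : IsDyadicBump φ) (ξ : EuclideanSpace ℝ (Fin d)) : φ ξ ≤ 1 := by
  by_cases h : ξ = 0
  · rw [h, phi_zero hφ]; norm_num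
  · have := le_hasSum (hφ.partition ξ h) 0 (fun j _ => hφ.nonneg _)
    simpa using this

/-- Finite dyadic sum `∑_{|k| ≤ N} φ(2^{-k} ξ)`. -/
noncomputable def PN (φ : EuclideanSpace ℝ (Fin d) → ℝ) (N : ℤ) (ξ : EuclideanSpace ℝ (Fin d)) : ℝ :=
  ∑ k ∈ Finset.Icc (-N) N, φ ((2:ℝ) ^ (-k) • ξ)

lemma PN_supp (hφ : IsDyadicBump φ) {N : ℤ} {ξ : EuclideanSpace ℝ (Fin d)} (h : PN φ N ξ ≠ 0) :
    3/4 * (2:ℝ) ^ (-N) ≤ ‖ξ‖ ∧ ‖ξ‖ ≤ 8/3 * (2:ℝ) ^ N := by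
  obtain ⟨k, hk, h⟩ := Finset.exists_ne_zero_of_sum_ne_zero h
  have := phi_supp hφ h
  rw [Finset.mem_Icc] at hk
  have h1 : (2:ℝ) ^ (-N) ≤ (2:ℝ) ^ k := zpow_le_zpow_right₀ (by norm_num) hk.1
  have h2 : (2:ℝ) ^ k ≤ (2:ℝ) ^ N := zpow_le_zpow_right₀ (by norm_num) hk.2
  constructor <;> linarith

lemma PN_ann (hφ : IsDyadicBump φ) (N : ℤ) : Ann (PN φ N) where
  smooth := by
    unfold PN
    refine ContDiff.sum fun k _ => ?_
    exact hφ.smooth.comp (contDiff_const_smul _)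
  supp := ⟨3/4 * (2:ℝ) ^ (-N), 8/3 * (2:ℝ) ^ N, by positivity, fun ξ h => PN_supp hφ h⟩

lemma PN_one (hφ : IsDyadicBump φ) {N : ℤ} {ξ : EuclideanSpace ℝ (Fin d)}
    (h1 : 8/3 * (2:ℝ) ^ (-N-1) < ‖ξ‖) (h2 : ‖ξ‖ < 3/4 * (2:ℝ) ^ (N+1)) : PN φ N ξ = 1 := by
  have h0 : ξ ≠ 0 := by
    rintro rfl
    have : (0:ℝ) < 8/3 * (2:ℝ) ^ (-N-1) := by positivity
    simp at h1; linarith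
  refine HasSum.unique ?_ (hφ.partition ξ h0)
  apply hasSum_sum_of_ne_finset_zero
  intro k hk
  by_contra h
  have := phi_supp hφ h
  rw [Finset.mem_Icc, not_and_or, not_le, not_le] at hk
  rcases hk with hk | hk
  · have : (2:ℝ) ^ k ≤ (2:ℝ) ^ (-N-1) := zpow_le_zpow_right₀ (by norm_num) (by omega)
    linarith
  · have : (2:ℝ) ^ (N+1) ≤ (2:ℝ) ^ k := zpow_le_zpow_right₀ (by norm_num) (by omega)
    linarith

lemma PN_sc_one (hφ : IsDyadicBump φ) {m : ℤ} {ξ : EuclideanSpace ℝ (Fin d)}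
    (h1 : 1/6 * (2:ℝ) ^ m < ‖ξ‖) (h2 : ‖ξ‖ < 12 * (2:ℝ) ^ m) :
    PN φ 4 ((2:ℝ) ^ (-m) • ξ) = 1 := by
  have h0 : (0:ℝ) < (2:ℝ) ^ m := by positivity
  apply PN_one hφ <;> rw [norm_sc, zpow_neg]
  · rw [inv_mul_eq_div, lt_div_iff₀ h0]
    refine lt_of_le_of_lt ?_ h1
    gcongr; norm_num [zpow_neg]
  · rw [inv_mul_eq_div, div_lt_iff₀ h0]
    refine lt_of_lt_of_le h2 ?_
    gcongr; norm_num [zpow_neg]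

lemma PN8_mul (hφ : IsDyadicBump φ) (ξ : EuclideanSpace ℝ (Fin d)) :
    PN φ 8 ξ * PN φ 4 ξ = PN φ 4 ξ := by
  by_cases h : PN φ 4 ξ = 0
  · simp [h]
  · have := PN_supp hφ h
    rw [PN_one hφ, one_mul]
    · refine lt_of_lt_of_le ?_ this.1; norm_num [zpow_neg]
    · refine lt_of_le_of_lt this.2 ?_; norm_num [zpow_neg]

/-- Low frequency cutoff. -/
noncomputable def chi (φ : EuclideanSpace ℝ (Fin d) → ℝ) (ξ : EuclideanSpace ℝ (Fin d)) : ℝ :=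
  1 - ∑' n : ℕ, φ ((2:ℝ) ^ (-(n:ℤ)) • ξ)

lemma sum_up_summable (hφ : IsDyadicBump φ) (ξ : EuclideanSpace ℝ (Fin d)) :
    Summable (fun n : ℕ => φ ((2:ℝ) ^ (-(n:ℤ)) • ξ)) := by
  by_cases h : ξ = 0
  · simp [h, phi_zero hφ]
  · exact (hφ.partition ξ h).summable.comp_injective (i := fun n : ℕ => (n : ℤ)) Nat.cast_injective

/-- `∑_{m ≥ J} φ(2^{-m} ξ) = 1 - χ(2^{-J} ξ)`. -/
lemma hasSum_up (hφ : IsDyadicBump φ) (J : ℤ) (ξ : EuclideanSpace ℝ (Fin d)) :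
    HasSum (fun n : ℕ => φ ((2:ℝ) ^ (-(J + n)) • ξ)) (1 - chi φ ((2:ℝ) ^ (-J) • ξ)) := by
  have := (sum_up_summable hφ ((2:ℝ) ^ (-J) • ξ)).hasSum
  unfold chi
  rw [_root_.sub_sub_cancel]
  convert this using 3 with n
  rw [smul_smul, ← zpow_add₀ (by norm_num)]
  congr 2; ring

lemma chi_down_aux (hφ : IsDyadicBump φ) {ξ : EuclideanSpace ℝ (Fin d)} (h : ξ ≠ 0) :
    HasSum (fun n : ℕ => φ ((2:ℝ) ^ ((n:ℤ) + 1) • ξ)) (chi φ ξ) := by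
  have h1 := hφ.partition ξ h
  have hs : Summable (fun n : ℕ => φ ((2:ℝ) ^ ((n:ℤ) + 1) • ξ)) := by
    have := h1.summable.comp_injective (i := fun n : ℕ => -((n : ℤ) + 1))
      (by intro a b hab; simpa using hab)
    simpa only [Function.comp_def, neg_neg] using this
  have h2 := HasSum.of_nat_of_neg_add_one (f := fun j : ℤ => φ ((2:ℝ) ^ (-j) • ξ))
    (sum_up_summable hφ ξ).hasSum (by simpa using hs.hasSum)
  have h3 := h1.unique h2
  convert hs.hasSum using 1
  unfold chi
  linarith

/-- `χ(2^{-J}ξ) = ∑_{m < J} φ(2^{-m} ξ)` off the origin. -/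
lemma hasSum_down (hφ : IsDyadicBump φ) (J : ℤ) {ξ : EuclideanSpace ℝ (Fin d)} (h : ξ ≠ 0) :
    HasSum (fun n : ℕ => φ ((2:ℝ) ^ (-(J - 1 - n)) • ξ)) (chi φ ((2:ℝ) ^ (-J) • ξ)) := by
  have := chi_down_aux hφ (ξ := (2:ℝ) ^ (-J) • ξ) (smul_ne_zero (by positivity) h)
  convert this using 3 with n
  rw [smul_smul, ← zpow_add₀ (by norm_num)]
  congr 2; ring

lemma chi_eq_one (hφ : IsDyadicBump φ) {J : ℤ} {ξ : EuclideanSpace ℝ (Fin d)}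
    (h : ‖ξ‖ < 3/4 * (2:ℝ) ^ J) : chi φ ((2:ℝ) ^ (-J) • ξ) = 1 := by
  have h1 := hasSum_up hφ J ξ
  have : (fun n : ℕ => φ ((2:ℝ) ^ (-(J + n)) • ξ)) = fun _ => 0 := by
    ext n
    by_contra h'
    have h3 := (phi_supp hφ h').1
    have : (2:ℝ) ^ J ≤ (2:ℝ) ^ (J + n) := zpow_le_zpow_right₀ (by norm_num) (by omega)
    linarith
  rw [this] at h1
  have := h1.unique hasSum_zero
  linarith

lemma chi_supp (hφ : IsDyadicBump φ) {J : ℤ} {ξ : EuclideanSpace ℝ (Fin d)}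
    (h : chi φ ((2:ℝ) ^ (-J) • ξ) ≠ 0) : ‖ξ‖ ≤ 4/3 * (2:ℝ) ^ J := by
  by_contra hc
  push Not at hc
  have h0 : ξ ≠ 0 := by
    rintro rfl
    have : (0:ℝ) < 4/3 * (2:ℝ) ^ J := by positivity
    simp at hc; linarith
  have h1 := hasSum_down hφ J h0
  have : (fun n : ℕ => φ ((2:ℝ) ^ (-(J - 1 - n)) • ξ)) = fun _ => 0 := by
    ext n
    by_contra h'
    have h3 := (phi_supp hφ h').2
    have : (2:ℝ) ^ (J - 1 - n) ≤ (2:ℝ) ^ (J - 1) := zpow_le_zpow_right₀ (by norm_num) (by omega)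
    rw [zpow_sub_one₀ (by norm_num)] at this
    linarith
  rw [this] at h1
  exact h (h1.unique hasSum_zero)

lemma chi_isMul (hφ : IsDyadicBump φ) : ∃ C, 0 ≤ C ∧ IsMul (fun ξ => (chi φ ξ : ℂ)) C := by
  have key : ∀ ξ, ‖ξ‖ < 3 → chi φ ξ = 1 - (φ ξ + φ ((2:ℝ) ^ (-(1:ℤ)) • ξ)) := by
    intro ξ hξ
    unfold chi
    rw [tsum_eq_sum (s := Finset.range 2)]
    · simp [Finset.sum_range_succ]
    · intro n hn
      by_contra h
      have := (phi_supp hφ h).1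
      have h2 : (2:ℝ) ^ (2:ℤ) ≤ (2:ℝ) ^ (n:ℤ) := by
        apply zpow_le_zpow_right₀ (by norm_num)
        simp at hn; omega
      norm_num at h2 this
      linarith
  have ksupp : ∀ ξ, chi φ ξ ≠ 0 → ‖ξ‖ ≤ 4/3 := by
    intro ξ h
    have := chi_supp hφ (J := 0) (ξ := ξ) (by simpa using h)
    simpa using this
  apply exists_isMul
  · refine Complex.ofRealCLM.contDiff.comp (f := chi φ) ?_
    rw [contDiff_iff_contDiffAt]
    intro ξ
    by_cases h : ‖ξ‖ < 3
    · have h1 : chi φ =ᶠ[nhds ξ] fun ξ => 1 - (φ ξ + φ ((2:ℝ) ^ (-(1:ℤ)) • ξ)) := by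
        filter_upwards [(isOpen_lt continuous_norm continuous_const).mem_nhds h] with η hη
        exact key η hη
      refine ContDiffAt.congr_of_eventuallyEq ?_ h1
      have h2 : ContDiff ℝ ∞ fun ξ => φ ((2:ℝ) ^ (-(1:ℤ)) • ξ) :=
        hφ.smooth.comp (contDiff_const_smul _)
      exact (contDiff_const.sub (hφ.smooth.add h2)).contDiffAt
    · have h1 : chi φ =ᶠ[nhds ξ] fun ξ => 0 := by
        have : (2:ℝ) < ‖ξ‖ := by linarith
        filter_upwards [(isOpen_lt continuous_const continuous_norm).mem_nhds this] with η hη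
        by_contra hc
        have := ksupp η hc
        have hη' : (2:ℝ) < ‖η‖ := hη
        linarith
      exact contDiffAt_const.congr_of_eventuallyEq h1
  · refine HasCompactSupport.intro (isCompact_closedBall 0 (4/3)) ?_
    intro ξ hξ
    have : chi φ ξ = 0 := by
      by_contra h'
      have := ksupp ξ h'
      simp at hξ
      linarith
    simp [this]

end bump

open MeasureTheory Real FourierTransform ENNReal
open scoped ContDiff

/-- Euclidean space. -/
abbrev EV (d : ℕ) := EuclideanSpace ℝ (Fin d)

section helpers
variable {d : ℕ}

lemma eL_const (c : ℂ) (u : EV d → ℂ) (p : ℝ≥0∞) :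
    eLpNorm (fun x => c * u x) p volume = ‖c‖ₑ * eLpNorm u p volume := by
  have := eLpNorm_const_smul c u p (volume : Measure (EV d))
  simpa [Pi.smul_def] using this

lemma enorm_ofReal' {c : ℝ} (hc : 0 ≤ c) : ‖((c : ℝ) : ℂ)‖ₑ = ENNReal.ofReal c := by
  rw [← ofReal_norm, Complex.norm_real, Real.norm_of_nonneg hc]

lemma fInv_cmul (c : ℂ) (a : EV d → ℂ) :
    𝓕⁻ (fun ξ => c * a ξ) = fun x => c * 𝓕⁻ a x := by
  ext x
  rw [fInv_eq_PH, fInv_eq_PH, PH_const_mul]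

lemma fInv_sum {ι : Type*} (S : Finset ι) (a : ι → EV d → ℂ) (ha : ∀ i ∈ S, Integrable (a i)) :
    𝓕⁻ (fun ξ => ∑ i ∈ S, a i ξ) = fun x => ∑ i ∈ S, 𝓕⁻ (a i) x := by
  ext x
  simp only [fInv_eq_PH]
  rw [PH_sum measurable_id S ha]

lemma BT_cmul (c : ℂ) (W : EV d × EV d → ℂ) :
    BT (fun z => c * W z) = fun x => c * BT W x := by
  ext x; exact PH_const_mul c x

lemma meas_add : Measurable (fun z : EV d × EV d => z.1 + z.2) := by fun_prop

lemma BT_cont {W : EV d × EV d → ℂ} (h : Integrable W (volume.prod volume)) :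
    Continuous (BT W) := PH_continuous meas_add h

lemma eL_BT_sub {W W' : EV d × EV d → ℂ} (h : Integrable W (volume.prod volume))
    (h' : Integrable W' (volume.prod volume)) {p : ℝ≥0∞} (hp : 1 ≤ p) :
    eLpNorm (BT (fun z => W z - W' z)) p volume ≤
      eLpNorm (BT W) p volume + eLpNorm (BT W') p volume := by
  have : BT (fun z => W z - W' z) = BT W - BT W' := by
    ext x; exact PH_sub meas_add h h' x
  rw [this]
  exact eLpNorm_sub_le (BT_cont h).aestronglyMeasurable (BT_cont h').aestronglyMeasurable hp

lemma eL_BT_sum {ι : Type*} (S : Finset ι) {W : ι → EV d × EV d → ℂ}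
    (h : ∀ i ∈ S, Integrable (W i) (volume.prod volume)) {p : ℝ≥0∞} (hp : 1 ≤ p) :
    eLpNorm (BT (fun z => ∑ i ∈ S, W i z)) p volume ≤
      ∑ i ∈ S, eLpNorm (BT (W i)) p volume := by
  have : BT (fun z => ∑ i ∈ S, W i z) = ∑ i ∈ S, BT (W i) := by
    ext x; rw [Finset.sum_apply]; exact PH_sum meas_add S h x
  rw [this]
  exact eLpNorm_sum_le (fun i hi => (BT_cont (h i hi)).aestronglyMeasurable) hp

lemma two_rpow_mul (x y : ℝ) : (2:ℝ) ^ x * (2:ℝ) ^ y = (2:ℝ) ^ (x + y) :=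
  (Real.rpow_add (by norm_num) x y).symm

lemma two_zpow (j : ℤ) : (2:ℝ) ^ j = (2:ℝ) ^ (j : ℝ) := (Real.rpow_intCast 2 j).symm

lemma norm_rpow_sc (j : ℤ) (β : ℝ) (ξ : EV d) :
    ‖ξ‖ ^ β = (2:ℝ) ^ (β * j) * ‖(2:ℝ) ^ (-j) • ξ‖ ^ β := by
  rw [norm_sc, Real.mul_rpow (by positivity) (by positivity), ← mul_assoc, two_zpow,
    ← Real.rpow_mul (by norm_num), two_rpow_mul]
  have : β * (j:ℝ) + ((-j : ℤ) : ℝ) * β = 0 := by push_cast; ring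
  rw [this]; simp

lemma coord_sc (j : ℤ) (i : Fin d) (ξ : EV d) :
    ξ i = (2:ℝ) ^ (j:ℝ) * ((2:ℝ) ^ (-j) • ξ) i := by
  rw [PiLp.smul_apply, smul_eq_mul, ← mul_assoc, two_zpow, two_rpow_mul]
  simp

lemma mu_sc1 (θ : EV d → ℝ) (β : ℝ) (j : ℤ) (ξ : EV d) :
    ((θ ((2:ℝ) ^ (-j) • ξ) : ℝ) : ℂ) * ((‖ξ‖ ^ β : ℝ) : ℂ) =
      (((2:ℝ) ^ (β * j) : ℝ) : ℂ) * mu θ β (fun _ => 1) ((2:ℝ) ^ (-j) • ξ) := by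
  unfold mu
  rw [norm_rpow_sc j β ξ]
  push_cast; ring

lemma mu_sci (θ : EV d → ℝ) (β : ℝ) (i : Fin d) (j : ℤ) (ξ : EV d) :
    ((θ ((2:ℝ) ^ (-j) • ξ) : ℝ) : ℂ) * ((‖ξ‖ ^ β : ℝ) : ℂ) * (ξ i : ℂ) =
      (((2:ℝ) ^ ((β + 1) * j) : ℝ) : ℂ) * mu θ β (fun ξ => ξ i) ((2:ℝ) ^ (-j) • ξ) := by
  unfold mu
  rw [norm_rpow_sc j β ξ, coord_sc j i ξ, show (β + 1) * (j:ℝ) = β * j + j by ring, ← two_rpow_mul]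
  push_cast
  ring_nf

/-- A multiplier integrable product. -/
lemma prod_int {M : EV d → ℂ} {C : ℝ} (h : IsMul M C) (t : ℝ) {a b : EV d → ℂ}
    (ha : Integrable a) (hb : Integrable b) :
    Integrable (fun z : EV d × EV d => M (t • (z.1 + z.2)) * (a z.1 * b z.2))
      (volume.prod volume) := by
  refine (ha.mul_prod hb).bdd_mul (c := C) ?_ ?_
  · exact (h.continuous.comp (by fun_prop)).aestronglyMeasurable
  · filter_upwards with x using h.bdd _

lemma prod_int2 {M : EV d → ℂ} {C : ℝ} (h : IsMul M C) (t : ℝ) {a b : EV d → ℂ}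
    (ha : Integrable a) (hb : Integrable b) :
    Integrable (fun z : EV d × EV d => (M (t • (z.1 + z.2)) - M (t • z.2)) * (a z.1 * b z.2))
      (volume.prod volume) := by
  refine (ha.mul_prod hb).bdd_mul (c := C + C) ?_ ?_
  · exact ((h.continuous.comp (by fun_prop)).sub (h.continuous.comp (by fun_prop))).aestronglyMeasurable
  · filter_upwards with x using (norm_sub_le _ _).trans (add_le_add (h.bdd _) (h.bdd _))

end helpers

section data
variable {d : ℕ} {φ : EV d → ℝ}

/-- Norm of the dyadic block of `𝓕⁻ a`. -/
noncomputable def nb (φ : EV d → ℝ) (p : ℝ≥0∞) (a : EV d → ℂ) (k : ℤ) : ℝ≥0∞ :=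
  eLpNorm (𝓕⁻ (fun ξ => ((φ ((2:ℝ) ^ (-k) • ξ) : ℝ) : ℂ) * a ξ)) p volume

lemma phi_isMul (hφ : IsDyadicBump φ) : ∃ C, 0 ≤ C ∧ IsMul (fun ξ => (φ ξ : ℂ)) C := by
  obtain ⟨C, h0, h⟩ := (phi_ann hφ).isMul 0 (P := fun _ => 1) contDiff_const
  refine ⟨C, h0, ?_⟩
  convert h using 2 with ξ
  rw [mu_zero_one]

lemma PN_isMul (hφ : IsDyadicBump φ) (N : ℤ) : ∃ C, 0 ≤ C ∧ IsMul (fun ξ => (PN φ N ξ : ℂ)) C := by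
  obtain ⟨C, h0, h⟩ := (PN_ann hφ N).isMul 0 (P := fun _ => 1) contDiff_const
  refine ⟨C, h0, ?_⟩
  convert h using 2 with ξ
  rw [mu_zero_one]

lemma PN_block (hφ : IsDyadicBump φ) (p : ℝ≥0∞) (hp : 1 ≤ p) (N : ℤ) {b : EV d → ℂ}
    (hb : Integrable b) (j : ℤ) :
    eLpNorm (𝓕⁻ (fun ζ => ((PN φ N ((2:ℝ) ^ (-j) • ζ) : ℝ) : ℂ) * b ζ)) p volume ≤
      ∑ k ∈ Finset.Icc (-N) N, nb φ p b (j + k) := by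
  obtain ⟨C, h0, h⟩ := phi_isMul hφ
  have e : (fun ζ => ((PN φ N ((2:ℝ) ^ (-j) • ζ) : ℝ) : ℂ) * b ζ) = fun ζ =>
      ∑ k ∈ Finset.Icc (-N) N, ((φ ((2:ℝ) ^ (-(j + k)) • ζ) : ℝ) : ℂ) * b ζ := by
    ext ζ
    unfold PN
    push_cast
    rw [Finset.sum_mul]
    refine Finset.sum_congr rfl fun k _ => ?_
    rw [smul_smul, ← zpow_add₀ (by norm_num)]
    congr 5; ring
  have hi : ∀ k : ℤ, Integrable (fun ζ => ((φ ((2:ℝ) ^ (-(j + k)) • ζ) : ℝ) : ℂ) * b ζ) :=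
    fun k => h.integrable_mul _ hb
  rw [e, fInv_sum _ _ (fun k _ => hi k)]
  have := eLpNorm_sum_le (μ := (volume : Measure (EV d))) (s := Finset.Icc (-N) N) (p := p)
    (f := fun k => 𝓕⁻ (fun ζ => ((φ ((2:ℝ) ^ (-(j + k)) • ζ) : ℝ) : ℂ) * b ζ))
    (fun k _ => (fInv_continuous (hi k)).aestronglyMeasurable) hp
  convert this using 2
  · ext x; simp
  · rfl

lemma low_v (hφ : IsDyadicBump φ) (p : ℝ≥0∞) (hp : 1 ≤ p) (β : ℝ) (i : Fin d) :
    ∃ C, 0 ≤ C ∧ ∀ (b : EV d → ℂ), Integrable b → ∀ j : ℤ,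
      Integrable (fun ζ => ((PN φ 4 ((2:ℝ) ^ (-j) • ζ) : ℝ) : ℂ) * ((‖ζ‖ ^ β : ℝ) : ℂ) *
        (ζ i : ℂ) * b ζ) ∧
      eLpNorm (𝓕⁻ (fun ζ => ((PN φ 4 ((2:ℝ) ^ (-j) • ζ) : ℝ) : ℂ) * ((‖ζ‖ ^ β : ℝ) : ℂ) *
        (ζ i : ℂ) * b ζ)) p volume ≤ ENNReal.ofReal (C * (2:ℝ) ^ ((β + 1) * j)) *
        ∑ k ∈ Finset.Icc (-4) 4, nb φ p b (j + k) := by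
  obtain ⟨C, h0, h⟩ := (PN_ann hφ 8).isMul β (contDiff_coord i)
  obtain ⟨C', h0', h'⟩ := PN_isMul hφ 4
  refine ⟨C, h0, fun b hb j => ?_⟩
  have e : (fun ζ : EV d => ((PN φ 4 ((2:ℝ) ^ (-j) • ζ) : ℝ) : ℂ) * ((‖ζ‖ ^ β : ℝ) : ℂ) *
        (ζ i : ℂ) * b ζ) = fun ζ => (((2:ℝ) ^ ((β + 1) * j) : ℝ) : ℂ) *
        (mu (PN φ 8) β (fun ξ => ξ i) ((2:ℝ) ^ (-j) • ζ) *
          (((PN φ 4 ((2:ℝ) ^ (-j) • ζ) : ℝ) : ℂ) * b ζ)) := by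
    ext ζ
    rw [← mul_assoc (((2:ℝ) ^ ((β + 1) * j) : ℝ) : ℂ), ← mu_sci]
    have c : ((PN φ 8 ((2:ℝ) ^ (-j) • ζ) : ℝ) : ℂ) * ((PN φ 4 ((2:ℝ) ^ (-j) • ζ) : ℝ) : ℂ) =
        ((PN φ 4 ((2:ℝ) ^ (-j) • ζ) : ℝ) : ℂ) := by exact_mod_cast PN8_mul hφ _
    linear_combination (-(((‖ζ‖ ^ β : ℝ) : ℂ) * (ζ i : ℂ) * b ζ)) * c
  have hi := h'.integrable_mul ((2:ℝ) ^ (-j)) hb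
  rw [e]
  refine ⟨(h.integrable_mul _ hi).const_mul _, ?_⟩
  rw [fInv_cmul, eL_const, enorm_ofReal' (by positivity), mul_comm C,
    ENNReal.ofReal_mul (by positivity), mul_assoc]
  gcongr
  refine (h.E0 _ hi p hp).trans ?_
  gcongr
  exact PN_block hφ p hp 4 hb j

end data

open MeasureTheory Real FourierTransform ENNReal
open scoped ContDiff

/-- Fourier-side data of the problem. -/
structure CData (d : ℕ) (s : ℝ) where
  a : Fin d → EV d → ℂ
  b : EV d → ℂ
  Gf : ℝ
  Gg : ℝ
  Gf0 : 0 ≤ Gf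
  Gg0 : 0 ≤ Gg
  ha : ∀ i, Integrable (a i)
  hb : Integrable b
  hbi : ∀ i, Integrable (fun ζ : EV d => (ζ i : ℂ) * b ζ)
  hbs : Integrable (fun ζ : EV d => ((‖ζ‖ ^ s : ℝ) : ℂ) * b ζ)
  hbsi : ∀ i, Integrable (fun ζ : EV d => ((‖ζ‖ ^ s : ℝ) : ℂ) * ((ζ i : ℂ) * b ζ))
  hdiv : ∀ ξ : EV d, ∑ i, (ξ i : ℂ) * a i ξ = 0
  hf : ∀ i x y, ‖𝓕⁻ (a i) x - 𝓕⁻ (a i) y‖ ≤ Gf * ‖x - y‖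
  hg : ∀ i x, ‖𝓕⁻ (fun ζ : EV d => (ζ i : ℂ) * b ζ) x‖ ≤ Gg

section ests
variable {d : ℕ} {φ : EV d → ℝ} {s : ℝ}

/-- Component of the commutator amplitude. -/
noncomputable def Wi (φ : EV d → ℝ) (D : CData d s) (j : ℤ) (i : Fin d) (z : EV d × EV d) : ℂ :=
  ((φ ((2:ℝ) ^ (-j) • (z.1 + z.2)) : ℝ) : ℂ) *
    (((‖z.1 + z.2‖ ^ s : ℝ) : ℂ) - ((‖z.2‖ ^ s : ℝ) : ℂ)) *
      (D.a i z.1 * ((z.2 i : ℂ) * D.b z.2))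

lemma om {x : ℝ} (y : ℝ) (S : ℝ≥0∞) (hx : 0 ≤ x) :
    ENNReal.ofReal x * (ENNReal.ofReal y * S) = ENNReal.ofReal (x * y) * S := by
  rw [← mul_assoc, ← ENNReal.ofReal_mul hx]

lemma tri {x y : EV d} : ‖x‖ - ‖y‖ ≤ ‖x + y‖ := by
  have := norm_sub_le (x + y) y
  rw [add_sub_cancel_right] at this
  linarith

lemma low_key (hφ : IsDyadicBump φ) (j : ℤ) (η ζ : EV d) :
    chi φ ((2:ℝ) ^ (-(j-4)) • η) * φ ((2:ℝ) ^ (-j) • (η + ζ)) * PN φ 4 ((2:ℝ) ^ (-j) • ζ) =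
      chi φ ((2:ℝ) ^ (-(j-4)) • η) * φ ((2:ℝ) ^ (-j) • (η + ζ)) := by
  by_cases h1 : chi φ ((2:ℝ) ^ (-(j-4)) • η) = 0
  · rw [h1]; ring
  by_cases h2 : φ ((2:ℝ) ^ (-j) • (η + ζ)) = 0
  · rw [h2]; ring
  have k1 := chi_supp hφ h1
  have k2 := phi_supp hφ h2
  have h0 : (0:ℝ) < (2:ℝ) ^ j := by positivity
  rw [zpow_sub₀ (by norm_num)] at k1
  norm_num at k1
  have t1 := norm_add_le η ζ
  have t2 := tri (x := ζ) (y := η)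
  rw [add_comm ζ] at t2
  rw [PN_sc_one hφ, mul_one] <;> linarith [k2.1, k2.2]

lemma low_i (hφ : IsDyadicBump φ) (s : ℝ) (p : ℝ≥0∞) (hp : 1 ≤ p) (i : Fin d) :
    ∃ C, 0 ≤ C ∧ ∀ (D : CData d s) (j : ℤ),
      Integrable (fun z => ((chi φ ((2:ℝ) ^ (-(j-4)) • z.1) : ℝ) : ℂ) * Wi φ D j i z)
        (volume.prod volume) ∧
      eLpNorm (BT (fun z => ((chi φ ((2:ℝ) ^ (-(j-4)) • z.1) : ℝ) : ℂ) * Wi φ D j i z)) p volume ≤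
        ENNReal.ofReal (C * D.Gf * (2:ℝ) ^ (s * j)) *
          ∑ k ∈ Finset.Icc (-4) 4, nb φ p D.b (j + k) := by
  obtain ⟨Cv, hCv, hv⟩ := low_v hφ p hp 0 i
  obtain ⟨Cw, hCw, hw⟩ := low_v hφ p hp s i
  obtain ⟨Cx, hCx, hx⟩ := chi_isMul hφ
  obtain ⟨Cp, hCp, hpm⟩ := phi_isMul hφ
  obtain ⟨Ca, hCa, hA⟩ := (phi_ann hφ).isMul s (P := fun _ => 1) contDiff_const
  refine ⟨Ca * Cx * Cv + Cp * Cx * Cw, by positivity, fun D j => ?_⟩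
  obtain ⟨v1, v2⟩ := hv D.b D.hb j
  obtain ⟨w1, w2⟩ := hw D.b D.hb j
  have hu := hx.integrable_mul ((2:ℝ) ^ (-(j-4))) (D.ha i)
  have hul := hx.E0lip ((2:ℝ) ^ (-(j-4))) (D.ha i) D.Gf D.Gf0 (D.hf i)
  have e : (fun z => ((chi φ ((2:ℝ) ^ (-(j-4)) • z.1) : ℝ) : ℂ) * Wi φ D j i z) = fun z =>
      (((2:ℝ) ^ (s * j) : ℝ) : ℂ) * ((mu φ s (fun _ => 1) ((2:ℝ) ^ (-j) • (z.1 + z.2)) -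
        mu φ s (fun _ => 1) ((2:ℝ) ^ (-j) • z.2)) *
        ((fun ξ => ((chi φ ((2:ℝ) ^ (-(j-4)) • ξ) : ℝ) : ℂ) * D.a i ξ) z.1 *
         (fun ζ : EV d => ((PN φ 4 ((2:ℝ) ^ (-j) • ζ) : ℝ) : ℂ) * ((‖ζ‖ ^ (0:ℝ) : ℝ) : ℂ) *
        (ζ i : ℂ) * D.b ζ) z.2)) -
      ((fun ξ => (φ ξ : ℂ)) ((2:ℝ) ^ (-j) • (z.1 + z.2)) -
        (fun ξ => (φ ξ : ℂ)) ((2:ℝ) ^ (-j) • z.2)) *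
        ((fun ξ => ((chi φ ((2:ℝ) ^ (-(j-4)) • ξ) : ℝ) : ℂ) * D.a i ξ) z.1 *
         (fun ζ : EV d => ((PN φ 4 ((2:ℝ) ^ (-j) • ζ) : ℝ) : ℂ) * ((‖ζ‖ ^ s : ℝ) : ℂ) *
        (ζ i : ℂ) * D.b ζ) z.2) := by
    ext z
    have h1 := mu_sc1 φ s j (z.1 + z.2)
    have h2 := mu_sc1 φ s j z.2
    have h3 : ((chi φ ((2:ℝ) ^ (-(j-4)) • z.1) : ℝ) : ℂ) *
      ((φ ((2:ℝ) ^ (-j) • (z.1 + z.2)) : ℝ) : ℂ) * ((PN φ 4 ((2:ℝ) ^ (-j) • z.2) : ℝ) : ℂ) =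
      ((chi φ ((2:ℝ) ^ (-(j-4)) • z.1) : ℝ) : ℂ) * ((φ ((2:ℝ) ^ (-j) • (z.1 + z.2)) : ℝ) : ℂ) := by
      exact_mod_cast low_key hφ j z.1 z.2
    simp only [Wi, Real.rpow_zero, Complex.ofReal_one, mul_one]
    linear_combination
      (((chi φ ((2:ℝ) ^ (-(j-4)) • z.1) : ℝ) : ℂ) * ((PN φ 4 ((2:ℝ) ^ (-j) • z.2) : ℝ) : ℂ) *
        D.a i z.1 * (z.2 i : ℂ) * D.b z.2) * (h1 - h2) -
      ((((‖z.1 + z.2‖ ^ s : ℝ) : ℂ) - ((‖z.2‖ ^ s : ℝ) : ℂ)) *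
        (D.a i z.1 * ((z.2 i : ℂ) * D.b z.2))) * h3
  have i1 := prod_int2 hA ((2:ℝ) ^ (-j)) hu v1
  have i2 := prod_int2 hpm ((2:ℝ) ^ (-j)) hu w1
  rw [e]
  refine ⟨(i1.const_mul _).sub i2, (eL_BT_sub (i1.const_mul _) i2 hp).trans ?_⟩
  have b1 := hA.E2 ((2:ℝ) ^ (-j)) hu v1 p hp (by positivity) _ (mul_nonneg hCx D.Gf0) hul
  have b2 := hpm.E2 ((2:ℝ) ^ (-j)) hu w1 p hp (by positivity) _ (mul_nonneg hCx D.Gf0) hul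
  have hG := D.Gf0
  set S := ∑ k ∈ Finset.Icc (-4) 4, nb φ p D.b (j + k)
  have p1 : (2:ℝ) ^ (s * j) * ((2:ℝ) ^ (-j) * (2:ℝ) ^ ((0 + 1) * (j:ℝ))) = (2:ℝ) ^ (s * j) := by
    rw [two_zpow, two_rpow_mul, two_rpow_mul]; congr 1; push_cast; ring
  have p2 : (2:ℝ) ^ (-j) * (2:ℝ) ^ ((s + 1) * (j:ℝ)) = (2:ℝ) ^ (s * j) := by
    rw [two_zpow, two_rpow_mul]; congr 1; push_cast; ring
  rw [BT_cmul, eL_const, enorm_ofReal' (by positivity)]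
  calc _ ≤ ENNReal.ofReal ((2:ℝ) ^ (s * j)) * (ENNReal.ofReal ((2:ℝ) ^ (-j) * Ca * (Cx * D.Gf)) *
          (ENNReal.ofReal (Cv * (2:ℝ) ^ ((0 + 1) * (j:ℝ))) * S)) +
        ENNReal.ofReal ((2:ℝ) ^ (-j) * Cp * (Cx * D.Gf)) *
          (ENNReal.ofReal (Cw * (2:ℝ) ^ ((s + 1) * (j:ℝ))) * S) := by
        refine add_le_add ?_ ?_
        · refine mul_le_mul_right (b1.trans ?_) _
          exact mul_le_mul_right v2 _
        · refine b2.trans ?_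
          exact mul_le_mul_right w2 _
    _ = _ := by
        rw [om _ _ (by positivity), om _ _ (by positivity), om _ _ (by positivity), ← add_mul,
          ← ENNReal.ofReal_add (by positivity) (by positivity)]
        congr 2
        linear_combination (Ca * Cx * D.Gf * Cv) * p1 + (Cp * Cx * D.Gf * Cw) * p2

end ests

open MeasureTheory Real FourierTransform ENNReal
open scoped ContDiff

section ests2
variable {d : ℕ} {φ : EV d → ℝ} {s : ℝ}

lemma Wi_int (hφ : IsDyadicBump φ) (D : CData d s) (j : ℤ) (i : Fin d) :
    Integrable (Wi φ D j i) (volume.prod volume) := by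
  obtain ⟨Cp, hCp, hpm⟩ := phi_isMul hφ
  obtain ⟨Ca, hCa, hA⟩ := (phi_ann hφ).isMul s (P := fun _ => 1) contDiff_const
  have i1 := (prod_int hA ((2:ℝ) ^ (-j)) (D.ha i) (D.hbi i)).const_mul (((2:ℝ) ^ (s * j) : ℝ) : ℂ)
  have i2 := prod_int hpm ((2:ℝ) ^ (-j)) (D.ha i) (D.hbsi i)
  refine (i1.sub i2).congr ?_
  filter_upwards with z
  have h1 := mu_sc1 φ s j (z.1 + z.2)
  simp only [Wi, Pi.sub_apply]
  linear_combination (-(D.a i z.1 * ((z.2 i : ℂ) * D.b z.2))) * h1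

lemma cut_int {M : EV d → ℂ} {C : ℝ} (h : IsMul M C) (t : ℝ) {W : EV d × EV d → ℂ}
    (hW : Integrable W (volume.prod volume)) :
    Integrable (fun z : EV d × EV d => M (t • z.1) * W z) (volume.prod volume) := by
  refine hW.bdd_mul (c := C) ?_ ?_
  · exact (h.continuous.comp (by fun_prop)).aestronglyMeasurable
  · filter_upwards with x using h.bdd _

lemma near_sup (hφ : IsDyadicBump φ) (hs : 0 < s) :
    ∃ C, 0 ≤ C ∧ ∀ (D : CData d s) (J : ℤ) (i : Fin d),
      Integrable (fun ζ : EV d => ((chi φ ((2:ℝ) ^ (-J) • ζ) : ℝ) : ℂ) *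
          (((‖ζ‖ ^ s : ℝ) : ℂ) * ((ζ i : ℂ) * D.b ζ))) ∧ ∀ x,
      ‖𝓕⁻ (fun ζ : EV d => ((chi φ ((2:ℝ) ^ (-J) • ζ) : ℝ) : ℂ) *
          (((‖ζ‖ ^ s : ℝ) : ℂ) * ((ζ i : ℂ) * D.b ζ))) x‖ ≤ C * (2:ℝ) ^ (s * J) * D.Gg := by
  obtain ⟨Cx, hCx, hx⟩ := chi_isMul hφ
  obtain ⟨Cp, hCp, hpm⟩ := phi_isMul hφ
  obtain ⟨Ca, hCa, hA⟩ := (phi_ann hφ).isMul s (P := fun _ => 1) contDiff_const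
  have hq : (2:ℝ) ^ (-s) < 1 := Real.rpow_lt_one_of_one_lt_of_neg (by norm_num) (by linarith)
  have hq0 : (0:ℝ) < (2:ℝ) ^ (-s) := by positivity
  have hq1 : 0 ≤ (1 - (2:ℝ) ^ (-s))⁻¹ := inv_nonneg.2 (by linarith)
  refine ⟨Ca * (2:ℝ) ^ (-s) * (1 - (2:ℝ) ^ (-s))⁻¹, by positivity, fun D J i => ?_⟩
  have hG := D.Gg0
  refine ⟨hx.integrable_mul _ (D.hbsi i), fun x => ?_⟩
  have zero : (((‖(0 : EV d)‖ ^ s : ℝ) : ℂ) * (((0 : EV d) i : ℂ) * D.b 0)) = 0 := by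
    simp
  have H := PH_hasSum (V := EV d) (ν := volume) measurable_id
    (W := fun n ζ => ((φ ((2:ℝ) ^ (-(J - 1 - (n:ℤ))) • ζ) : ℝ) : ℂ) *
          (((‖ζ‖ ^ s : ℝ) : ℂ) * ((ζ i : ℂ) * D.b ζ)))
    (W₀ := fun ζ : EV d => ((chi φ ((2:ℝ) ^ (-J) • ζ) : ℝ) : ℂ) *
          (((‖ζ‖ ^ s : ℝ) : ℂ) * ((ζ i : ℂ) * D.b ζ)))
    (fun n => (hpm.integrable_mul _ (D.hbsi i)).1)
    (fun n ζ => φ ((2:ℝ) ^ (-(J - 1 - (n:ℤ))) • ζ) * ‖((‖ζ‖ ^ s : ℝ) : ℂ) * ((ζ i : ℂ) * D.b ζ)‖)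
    (fun ζ => chi φ ((2:ℝ) ^ (-J) • ζ) * ‖((‖ζ‖ ^ s : ℝ) : ℂ) * ((ζ i : ℂ) * D.b ζ)‖)
    (by
      refine (D.hbsi i).norm.bdd_mul (c := Cx) ?_ ?_
      · have := (Complex.continuous_re.comp hx.continuous)
        simp only [Function.comp_def, Complex.ofReal_re] at this
        exact (this.comp (by fun_prop)).aestronglyMeasurable
      · filter_upwards with ζ
        have := hx.bdd ((2:ℝ) ^ (-J) • ζ)
        rwa [Complex.norm_real] at this)
    (fun ζ => by
      by_cases h : ζ = 0
      · subst h; simp only [zero]; simp only [norm_zero, mul_zero]; exact hasSum_zero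
      · exact (hasSum_down hφ J h).mul_right _)
    (fun n ζ => by
      rw [norm_mul, Complex.norm_real, Real.norm_of_nonneg (hφ.nonneg _)])
    (fun ζ => by
      by_cases h : ζ = 0
      · subst h; simp only [zero, mul_zero]; exact hasSum_zero
      · have := (hasSum_down hφ J h)
        exact (Complex.hasSum_ofReal.2 this).mul_right _) x
  rw [fInv_eq_PH, ← H.tsum_eq]
  have hgeo := (hasSum_geometric_of_lt_one hq0.le hq).mul_left
    (Ca * (2:ℝ) ^ (-s) * (2:ℝ) ^ (s * J) * D.Gg)
  rw [show Ca * (2:ℝ) ^ (-s) * (1 - (2:ℝ) ^ (-s))⁻¹ * (2:ℝ) ^ (s * J) * D.Gg =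
    Ca * (2:ℝ) ^ (-s) * (2:ℝ) ^ (s * J) * D.Gg * (1 - (2:ℝ) ^ (-s))⁻¹ by ring]
  refine tsum_of_norm_bounded hgeo fun n => ?_
  rw [← fInv_eq_PH]
  have e : (fun ζ : EV d => ((φ ((2:ℝ) ^ (-(J - 1 - (n:ℤ))) • ζ) : ℝ) : ℂ) *
          (((‖ζ‖ ^ s : ℝ) : ℂ) * ((ζ i : ℂ) * D.b ζ))) = fun ζ =>
      (((2:ℝ) ^ (s * ((J - 1 - (n:ℤ) : ℤ) : ℝ)) : ℝ) : ℂ) *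
        (mu φ s (fun _ => 1) ((2:ℝ) ^ (-(J - 1 - (n:ℤ))) • ζ) * ((ζ i : ℂ) * D.b ζ)) := by
    ext ζ
    have h1 := mu_sc1 φ s (J - 1 - (n:ℤ)) ζ
    linear_combination ((ζ i : ℂ) * D.b ζ) * h1
  rw [e, fInv_cmul, norm_mul, Complex.norm_real, Real.norm_of_nonneg (by positivity)]
  have b1 := hA.E0sup ((2:ℝ) ^ (-(J - 1 - (n:ℤ)))) (D.hbi i) D.Gg (D.hg i) x
  have p1 : (2:ℝ) ^ (s * ((J - 1 - (n:ℤ) : ℤ) : ℝ)) =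
      (2:ℝ) ^ (-s) * (2:ℝ) ^ (s * J) * ((2:ℝ) ^ (-s)) ^ n := by
    rw [← Real.rpow_mul_natCast (by norm_num), two_rpow_mul, two_rpow_mul]
    congr 1; push_cast; ring
  calc _ ≤ (2:ℝ) ^ (s * ((J - 1 - (n:ℤ) : ℤ) : ℝ)) * (Ca * D.Gg) := by gcongr
    _ = _ := by rw [p1]; ring

lemma far_sup (hφ : IsDyadicBump φ) (s β : ℝ) :
    ∃ C, 0 ≤ C ∧ ∀ (D : CData d s) (m : ℤ), 
      Integrable (fun ζ : EV d => ((PN φ 4 ((2:ℝ) ^ (-m) • ζ) : ℝ) : ℂ) *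
          (((‖ζ‖ ^ β : ℝ) : ℂ) * D.b ζ)) ∧ ∀ x,
      ‖𝓕⁻ (fun ζ : EV d => ((PN φ 4 ((2:ℝ) ^ (-m) • ζ) : ℝ) : ℂ) *
          (((‖ζ‖ ^ β : ℝ) : ℂ) * D.b ζ)) x‖ ≤ C * (2:ℝ) ^ ((β - 1) * m) * D.Gg := by
  choose Cl hCl hl using fun l : Fin d => (PN_ann hφ 4).isMul (β - 2) (contDiff_coord l)
  refine ⟨∑ l, Cl l, Finset.sum_nonneg fun l _ => hCl l, fun D m => ?_⟩
  have e : (fun ζ : EV d => ((PN φ 4 ((2:ℝ) ^ (-m) • ζ) : ℝ) : ℂ) *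
          (((‖ζ‖ ^ β : ℝ) : ℂ) * D.b ζ)) = fun ζ => ∑ l : Fin d,
      (((2:ℝ) ^ ((β - 2 + 1) * m) : ℝ) : ℂ) *
        (mu (PN φ 4) (β - 2) (fun ξ => ξ l) ((2:ℝ) ^ (-m) • ζ) * ((ζ l : ℂ) * D.b ζ)) := by
    ext ζ
    have h1 := fun l => mu_sci (PN φ 4) (β - 2) l m ζ
    simp only [← mul_assoc]
    simp only [← h1]
    by_cases h0 : ζ = 0
    · have : PN φ 4 (0 : EV d) = 0 := by
        by_contra hc
        have := (PN_supp hφ hc).1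
        norm_num [zpow_neg] at this
      simp [h0, this]
    · have hn : ‖ζ‖ ^ β = ‖ζ‖ ^ (β - 2) * ∑ l, ζ l * ζ l := by
        have : ∑ l, ζ l * ζ l = ‖ζ‖ ^ (2:ℝ) := by
          rw [Real.rpow_two, EuclideanSpace.real_norm_sq_eq]
          simp [sq]
        rw [this, ← Real.rpow_add (norm_pos_iff.2 h0)]
        congr 1; ring
      rw [hn]
      push_cast
      rw [Finset.mul_sum, Finset.mul_sum, Finset.sum_mul]
      refine Finset.sum_congr rfl fun l _ => ?_
      ring
  have hi := fun l => (((hl l).integrable_mul ((2:ℝ) ^ (-m)) (D.hbi l)).const_mul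
    (((2:ℝ) ^ ((β - 2 + 1) * m) : ℝ) : ℂ))
  rw [e]
  refine ⟨integrable_finsetSum _ fun l _ => hi l, fun x => ?_⟩
  rw [fInv_sum _ _ (fun l _ => hi l)]
  refine (norm_sum_le _ _).trans ?_
  rw [Finset.sum_mul, Finset.sum_mul]
  refine Finset.sum_le_sum fun l _ => ?_
  rw [fInv_cmul, norm_mul, Complex.norm_real, Real.norm_of_nonneg (by positivity)]
  have b1 := (hl l).E0sup ((2:ℝ) ^ (-m)) (D.hbi l) D.Gg (D.hg l) x
  calc _ ≤ (2:ℝ) ^ ((β - 2 + 1) * m) * (Cl l * D.Gg) := by gcongr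
    _ = _ := by rw [show β - 2 + 1 = β - 1 by ring]; ring

lemma near_key (hφ : IsDyadicBump φ) (j m : ℤ) (hm : m ≤ j + 4) (η ζ : EV d) :
    φ ((2:ℝ) ^ (-m) • η) * φ ((2:ℝ) ^ (-j) • (η + ζ)) * chi φ ((2:ℝ) ^ (-(j+8)) • ζ) =
      φ ((2:ℝ) ^ (-m) • η) * φ ((2:ℝ) ^ (-j) • (η + ζ)) := by
  by_cases h1 : φ ((2:ℝ) ^ (-m) • η) = 0
  · rw [h1]; ring
  by_cases h2 : φ ((2:ℝ) ^ (-j) • (η + ζ)) = 0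
  · rw [h2]; ring
  have k1 := phi_supp hφ h1
  have k2 := phi_supp hφ h2
  have h0 : (0:ℝ) < (2:ℝ) ^ j := by positivity
  have t2 := tri (x := ζ) (y := η)
  rw [add_comm ζ] at t2
  have h3 : (2:ℝ) ^ m ≤ (2:ℝ) ^ (j + 4) := zpow_le_zpow_right₀ (by norm_num) hm
  rw [zpow_add₀ (by norm_num)] at h3
  norm_num at h3
  rw [chi_eq_one hφ, mul_one]
  rw [zpow_add₀ (by norm_num)]
  norm_num
  linarith [k2.1, k2.2, k1.1, k1.2]

lemma far_key (hφ : IsDyadicBump φ) (j m : ℤ) (hm : j + 5 ≤ m) (η ζ : EV d) :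
    φ ((2:ℝ) ^ (-m) • η) * φ ((2:ℝ) ^ (-j) • (η + ζ)) * PN φ 4 ((2:ℝ) ^ (-m) • ζ) =
      φ ((2:ℝ) ^ (-m) • η) * φ ((2:ℝ) ^ (-j) • (η + ζ)) := by
  by_cases h1 : φ ((2:ℝ) ^ (-m) • η) = 0
  · rw [h1]; ring
  by_cases h2 : φ ((2:ℝ) ^ (-j) • (η + ζ)) = 0
  · rw [h2]; ring
  have k1 := phi_supp hφ h1
  have k2 := phi_supp hφ h2
  have h0 : (0:ℝ) < (2:ℝ) ^ m := by positivity
  have t1 := tri (x := η) (y := ζ)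
  have t2 := tri (x := ζ) (y := η)
  rw [add_comm ζ] at t2
  have h3 : (2:ℝ) ^ (j + 5) ≤ (2:ℝ) ^ m := zpow_le_zpow_right₀ (by norm_num) hm
  rw [zpow_add₀ (by norm_num)] at h3
  norm_num at h3
  rw [PN_sc_one hφ, mul_one] <;> linarith [k2.1, k2.2, k1.1, k1.2]

lemma near_i (hφ : IsDyadicBump φ) (hs : 0 < s) (p : ℝ≥0∞) (hp : 1 ≤ p) :
    ∃ C, 0 ≤ C ∧ ∀ (D : CData d s) (j m : ℤ) (i : Fin d), m ≤ j + 4 →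
      eLpNorm (BT (fun z => ((φ ((2:ℝ) ^ (-m) • z.1) : ℝ) : ℂ) * Wi φ D j i z)) p volume ≤
        ENNReal.ofReal (C * D.Gg * (2:ℝ) ^ (s * j)) * nb φ p (D.a i) m := by
  obtain ⟨Cp, hCp, hpm⟩ := phi_isMul hφ
  obtain ⟨Cn, hCn, hn⟩ := near_sup (d := d) hφ hs
  obtain ⟨Ca, hCa, hA⟩ := (phi_ann hφ).isMul s (P := fun _ => 1) contDiff_const
  refine ⟨Ca + Cp * Cn * (2:ℝ) ^ (s * 8), by positivity, fun D j m i hm => ?_⟩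
  have hG := D.Gg0
  obtain ⟨n1, n2⟩ := hn D (j + 8) i
  have hu := hpm.integrable_mul ((2:ℝ) ^ (-m)) (D.ha i)
  have e : (fun z => ((φ ((2:ℝ) ^ (-m) • z.1) : ℝ) : ℂ) * Wi φ D j i z) = fun z =>
      (((2:ℝ) ^ (s * j) : ℝ) : ℂ) * (mu φ s (fun _ => 1) ((2:ℝ) ^ (-j) • (z.1 + z.2)) *
        ((fun ξ => ((φ ((2:ℝ) ^ (-m) • ξ) : ℝ) : ℂ) * D.a i ξ) z.1 *
         (fun ζ : EV d => (ζ i : ℂ) * D.b ζ) z.2)) -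
      (fun ξ => (φ ξ : ℂ)) ((2:ℝ) ^ (-j) • (z.1 + z.2)) *
        ((fun ξ => ((φ ((2:ℝ) ^ (-m) • ξ) : ℝ) : ℂ) * D.a i ξ) z.1 *
         (fun ζ : EV d => ((chi φ ((2:ℝ) ^ (-(j+8)) • ζ) : ℝ) : ℂ) *
          (((‖ζ‖ ^ s : ℝ) : ℂ) * ((ζ i : ℂ) * D.b ζ))) z.2) := by
    ext z
    have h1 := mu_sc1 φ s j (z.1 + z.2)
    have h3 : ((φ ((2:ℝ) ^ (-m) • z.1) : ℝ) : ℂ) *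
      ((φ ((2:ℝ) ^ (-j) • (z.1 + z.2)) : ℝ) : ℂ) * ((chi φ ((2:ℝ) ^ (-(j+8)) • z.2) : ℝ) : ℂ) =
      ((φ ((2:ℝ) ^ (-m) • z.1) : ℝ) : ℂ) * ((φ ((2:ℝ) ^ (-j) • (z.1 + z.2)) : ℝ) : ℂ) := by
      exact_mod_cast near_key hφ j m hm z.1 z.2
    simp only [Wi]
    linear_combination
      (((φ ((2:ℝ) ^ (-m) • z.1) : ℝ) : ℂ) * D.a i z.1 * (z.2 i : ℂ) * D.b z.2) * h1 +
      (((‖z.2‖ ^ s : ℝ) : ℂ) * (D.a i z.1 * ((z.2 i : ℂ) * D.b z.2))) * h3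
  have i1 := prod_int hA ((2:ℝ) ^ (-j)) hu (D.hbi i)
  have i2 := prod_int hpm ((2:ℝ) ^ (-j)) hu n1
  rw [e]
  refine (eL_BT_sub (i1.const_mul _) i2 hp).trans ?_
  have b1 := hA.E1 ((2:ℝ) ^ (-j)) hu (D.hbi i) p hp _ (D.hg i)
  have b2 := hpm.E1 ((2:ℝ) ^ (-j)) hu n1 p hp _ n2
  rw [BT_cmul, eL_const, enorm_ofReal' (by positivity)]
  have p1 : (2:ℝ) ^ (s * ((j + 8 : ℤ) : ℝ)) = (2:ℝ) ^ (s * 8) * (2:ℝ) ^ (s * j) := by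
    rw [two_rpow_mul]; congr 1; push_cast; ring
  refine (add_le_add (mul_le_mul_right b1 _) b2).trans (le_of_eq ?_)
  change _ * (_ * nb φ p (D.a i) m) + _ * nb φ p (D.a i) m = _
  rw [om _ _ (by positivity), ← add_mul, ← ENNReal.ofReal_add (by positivity) (by positivity), p1]
  congr 2
  ring

lemma far_all (hφ : IsDyadicBump φ) (s : ℝ) (p : ℝ≥0∞) (hp : 1 ≤ p) :
    ∃ C, 0 ≤ C ∧ ∀ (D : CData d s) (j m : ℤ), j + 5 ≤ m →
      eLpNorm (BT (fun z => ∑ i, ((φ ((2:ℝ) ^ (-m) • z.1) : ℝ) : ℂ) * Wi φ D j i z)) p volume ≤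
        ENNReal.ofReal (C * D.Gg * ((2:ℝ) ^ ((s + 1) * j - m) + (2:ℝ) ^ (j + (s - 1) * m))) *
          ∑ i, nb φ p (D.a i) m := by
  obtain ⟨Cp, hCp, hpm⟩ := phi_isMul hφ
  obtain ⟨Cv, hCv, hv⟩ := far_sup (d := d) hφ s 0
  obtain ⟨Cw, hCw, hw⟩ := far_sup (d := d) hφ s s
  choose Ca hCa hA using fun l : Fin d => (phi_ann hφ).isMul s (contDiff_coord l)
  choose Cb hCb hB using fun l : Fin d => (phi_ann hφ).isMul 0 (contDiff_coord l)
  have hT : 0 ≤ ∑ l, (Ca l * Cv + Cb l * Cw) :=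
    Finset.sum_nonneg fun l _ => add_nonneg (mul_nonneg (hCa l) hCv) (mul_nonneg (hCb l) hCw)
  refine ⟨∑ l, (Ca l * Cv + Cb l * Cw), hT, fun D j m hm => ?_⟩
  have hG := D.Gg0
  obtain ⟨v1, v2⟩ := hv D m
  obtain ⟨w1, w2⟩ := hw D m
  have hu := fun i => hpm.integrable_mul ((2:ℝ) ^ (-m)) (D.ha i)
  have e : (fun z => ∑ i, ((φ ((2:ℝ) ^ (-m) • z.1) : ℝ) : ℂ) * Wi φ D j i z) = fun z => ∑ i,
      ((((2:ℝ) ^ ((s + 1) * j) : ℝ) : ℂ) * (mu φ s (fun ξ => ξ i) ((2:ℝ) ^ (-j) • (z.1 + z.2)) *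
        ((fun ξ => ((φ ((2:ℝ) ^ (-m) • ξ) : ℝ) : ℂ) * D.a i ξ) z.1 *
         (fun ζ : EV d => ((PN φ 4 ((2:ℝ) ^ (-m) • ζ) : ℝ) : ℂ) *
          (((‖ζ‖ ^ (0:ℝ) : ℝ) : ℂ) * D.b ζ)) z.2)) -
      (((2:ℝ) ^ ((0 + 1) * (j:ℝ)) : ℝ) : ℂ) *
        (mu φ 0 (fun ξ => ξ i) ((2:ℝ) ^ (-j) • (z.1 + z.2)) *
        ((fun ξ => ((φ ((2:ℝ) ^ (-m) • ξ) : ℝ) : ℂ) * D.a i ξ) z.1 *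
         (fun ζ : EV d => ((PN φ 4 ((2:ℝ) ^ (-m) • ζ) : ℝ) : ℂ) *
          (((‖ζ‖ ^ s : ℝ) : ℂ) * D.b ζ)) z.2))) := by
    ext z
    have h3 : ((φ ((2:ℝ) ^ (-m) • z.1) : ℝ) : ℂ) *
      ((φ ((2:ℝ) ^ (-j) • (z.1 + z.2)) : ℝ) : ℂ) * ((PN φ 4 ((2:ℝ) ^ (-m) • z.2) : ℝ) : ℂ) =
      ((φ ((2:ℝ) ^ (-m) • z.1) : ℝ) : ℂ) * ((φ ((2:ℝ) ^ (-j) • (z.1 + z.2)) : ℝ) : ℂ) := by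
      exact_mod_cast far_key hφ j m hm z.1 z.2
    have h4 := D.hdiv z.1
    set Q : ℂ := ((φ ((2:ℝ) ^ (-m) • z.1) : ℝ) : ℂ) * ((φ ((2:ℝ) ^ (-j) • (z.1 + z.2)) : ℝ) : ℂ) *
      (((‖z.1 + z.2‖ ^ s : ℝ) : ℂ) - ((‖z.2‖ ^ s : ℝ) : ℂ)) * D.b z.2 with hQ
    have l1 : ∑ i, ((φ ((2:ℝ) ^ (-m) • z.1) : ℝ) : ℂ) * Wi φ D j i z =
        ∑ i, Q * ((z.1 + z.2) i : ℂ) * D.a i z.1 := by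
      have : ∑ i, Q * ((z.1 + z.2) i : ℂ) * D.a i z.1 =
          Q * ∑ i, (z.1 i : ℂ) * D.a i z.1 + ∑ i, Q * (z.2 i : ℂ) * D.a i z.1 := by
        rw [Finset.mul_sum, ← Finset.sum_add_distrib]
        refine Finset.sum_congr rfl fun i _ => ?_
        rw [PiLp.add_apply]; push_cast; ring
      rw [this, h4, mul_zero, zero_add]
      refine Finset.sum_congr rfl fun i _ => ?_
      simp only [Wi, hQ]; ring
    rw [l1]
    refine Finset.sum_congr rfl fun i _ => ?_
    have h1 := mu_sci φ s i j (z.1 + z.2)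
    have h2 := mu_sci φ 0 i j (z.1 + z.2)
    simp only [Real.rpow_zero, Complex.ofReal_one, mul_one, one_mul] at h2 ⊢
    simp only [hQ]
    linear_combination
      (((φ ((2:ℝ) ^ (-m) • z.1) : ℝ) : ℂ) * D.a i z.1 *
        ((PN φ 4 ((2:ℝ) ^ (-m) • z.2) : ℝ) : ℂ) * D.b z.2) * (h1 - ((‖z.2‖ ^ s : ℝ) : ℂ) * h2) -
      ((((‖z.1 + z.2‖ ^ s : ℝ) : ℂ) - ((‖z.2‖ ^ s : ℝ) : ℂ)) * D.b z.2 *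
         ((z.1 + z.2) i : ℂ) * D.a i z.1) * h3
  have i1 := fun i => (prod_int (hA i) ((2:ℝ) ^ (-j)) (hu i) v1).const_mul
    (((2:ℝ) ^ ((s + 1) * j) : ℝ) : ℂ)
  have i2 := fun i => (prod_int (hB i) ((2:ℝ) ^ (-j)) (hu i) w1).const_mul
    (((2:ℝ) ^ ((0 + 1) * (j:ℝ)) : ℝ) : ℂ)
  rw [e]
  refine (eL_BT_sum _ (fun i _ => (i1 i).sub (i2 i)) hp).trans ?_
  rw [Finset.mul_sum]
  refine Finset.sum_le_sum fun i _ => ?_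
  refine (eL_BT_sub (i1 i) (i2 i) hp).trans ?_
  have b1 := (hA i).E1 ((2:ℝ) ^ (-j)) (hu i) v1 p hp _ v2
  have b2 := (hB i).E1 ((2:ℝ) ^ (-j)) (hu i) w1 p hp _ w2
  rw [BT_cmul, eL_const, enorm_ofReal' (by positivity), BT_cmul, eL_const,
    enorm_ofReal' (by positivity)]
  refine (add_le_add (mul_le_mul_right b1 _) (mul_le_mul_right b2 _)).trans ?_
  change _ * (_ * nb φ p (D.a i) m) + _ * (_ * nb φ p (D.a i) m) ≤ _
  have hCai := hCa i
  have hCbi := hCb i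
  rw [om _ _ (by positivity), om _ _ (by positivity), ← add_mul,
    ← ENNReal.ofReal_add (by positivity) (by positivity)]
  gcongr ?_ * _
  apply ENNReal.ofReal_le_ofReal
  have p1 : (2:ℝ) ^ ((s + 1) * j) * (2:ℝ) ^ ((0 - 1) * (m:ℝ)) = (2:ℝ) ^ ((s + 1) * j - m) := by
    rw [two_rpow_mul]; congr 1; ring
  have p2 : (2:ℝ) ^ ((0 + 1) * (j:ℝ)) * (2:ℝ) ^ ((s - 1) * (m:ℝ)) = (2:ℝ) ^ (j + (s - 1) * m) := by
    rw [two_rpow_mul]; congr 1; ring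
  have hle : Ca i * Cv + Cb i * Cw ≤ ∑ l, (Ca l * Cv + Cb l * Cw) :=
    Finset.single_le_sum (f := fun l => Ca l * Cv + Cb l * Cw)
      (fun l _ => add_nonneg (mul_nonneg (hCa l) hCv) (mul_nonneg (hCb l) hCw)) (Finset.mem_univ i)
  have q1 : 0 ≤ Ca i * Cv := by positivity
  have q2 : 0 ≤ Cb i * Cw := by positivity
  set X := (2:ℝ) ^ ((s + 1) * j - m) with hX
  set Y := (2:ℝ) ^ (j + (s - 1) * m) with hY
  have hX0 : 0 ≤ X := by positivity
  have hY0 : 0 ≤ Y := by positivity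
  calc _ = (Ca i * Cv) * D.Gg * X + (Cb i * Cw) * D.Gg * Y := by
        linear_combination (Ca i * Cv * D.Gg) * p1 + (Cb i * Cw * D.Gg) * p2
    _ ≤ (Ca i * Cv + Cb i * Cw) * D.Gg * X + (Ca i * Cv + Cb i * Cw) * D.Gg * Y := by
        gcongr <;> linarith
    _ = (Ca i * Cv + Cb i * Cw) * D.Gg * (X + Y) := by ring
    _ ≤ _ := by gcongr

end ests2

open MeasureTheory Real FourierTransform ENNReal
open scoped ContDiff

section comb
variable {d : ℕ} {φ : EV d → ℝ} {s : ℝ}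

lemma term_all (hφ : IsDyadicBump φ) (hs : 0 < s) (p : ℝ≥0∞) (hp : 1 ≤ p) :
    ∃ C, 0 ≤ C ∧ ∀ (D : CData d s) (j : ℤ) (n : ℕ),
      eLpNorm (BT (fun z => ∑ i, ((φ ((2:ℝ) ^ (-(j - 4 + n)) • z.1) : ℝ) : ℂ) * Wi φ D j i z)) p
        volume ≤ ENNReal.ofReal (C * D.Gg * (2:ℝ) ^ (s * j) * (2:ℝ) ^ ((s - 1) * n)) *
          ∑ i, nb φ p (D.a i) (j - 4 + n) := by
  obtain ⟨C1, hC1, h1⟩ := near_i (d := d) hφ hs p hp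
  obtain ⟨C2, hC2, h2⟩ := far_all (d := d) hφ s p hp
  obtain ⟨Cp, hCp, hpm⟩ := phi_isMul hφ
  refine ⟨C1 * 256 + C2 * (16 + (2:ℝ) ^ (-4 * (s - 1))), by positivity, fun D j n => ?_⟩
  have hG := D.Gg0
  by_cases hn : n ≤ 8
  · refine (eL_BT_sum _ (fun i _ => cut_int hpm _ (Wi_int hφ D j i)) hp).trans ?_
    rw [Finset.mul_sum]
    refine Finset.sum_le_sum fun i _ => ?_
    refine (h1 D j (j - 4 + n) i (by omega)).trans ?_
    gcongr ?_ * _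
    apply ENNReal.ofReal_le_ofReal
    have k : (1:ℝ) ≤ 256 * (2:ℝ) ^ ((s - 1) * n) := by
      have : (2:ℝ) ^ (-8 : ℝ) ≤ (2:ℝ) ^ ((s - 1) * n) := by
        apply Real.rpow_le_rpow_of_exponent_le (by norm_num)
        have : (n:ℝ) ≤ 8 := by exact_mod_cast hn
        nlinarith [(Nat.cast_nonneg n : (0:ℝ) ≤ n)]
      have h8 : (2:ℝ) ^ (-8 : ℝ) = 1/256 := by
        rw [Real.rpow_neg (by norm_num)]; norm_num
      rw [h8] at this
      linarith
    calc C1 * D.Gg * (2:ℝ) ^ (s * j) ≤ C1 * D.Gg * (2:ℝ) ^ (s * j) * (256 * (2:ℝ) ^ ((s - 1) * n)) :=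
          le_mul_of_one_le_right (by positivity) k
      _ = (C1 * 256) * D.Gg * (2:ℝ) ^ (s * j) * (2:ℝ) ^ ((s - 1) * n) := by ring
      _ ≤ _ := by gcongr; exact le_add_of_nonneg_right (by positivity)
  · refine (h2 D j (j - 4 + n) (by omega)).trans ?_
    gcongr ?_ * _
    apply ENNReal.ofReal_le_ofReal
    have k1 : (2:ℝ) ^ ((s + 1) * j - ((j - 4 + n : ℤ) : ℝ)) ≤
        16 * ((2:ℝ) ^ (s * j) * (2:ℝ) ^ ((s - 1) * n)) := by
      have : (16:ℝ) = (2:ℝ) ^ (4:ℝ) := by norm_num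
      rw [this, two_rpow_mul, two_rpow_mul]
      apply Real.rpow_le_rpow_of_exponent_le (by norm_num)
      push_cast
      nlinarith [(Nat.cast_nonneg n : (0:ℝ) ≤ n)]
    have k2 : (2:ℝ) ^ (j + (s - 1) * ((j - 4 + n : ℤ) : ℝ)) =
        (2:ℝ) ^ (-4 * (s - 1)) * ((2:ℝ) ^ (s * j) * (2:ℝ) ^ ((s - 1) * n)) := by
      rw [two_rpow_mul, two_rpow_mul]
      congr 1; push_cast; ring
    rw [k2]
    calc _ ≤ C2 * D.Gg * (16 * ((2:ℝ) ^ (s * j) * (2:ℝ) ^ ((s - 1) * n)) +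
          (2:ℝ) ^ (-4 * (s - 1)) * ((2:ℝ) ^ (s * j) * (2:ℝ) ^ ((s - 1) * n))) := by gcongr
      _ = (C2 * (16 + (2:ℝ) ^ (-4 * (s - 1)))) * D.Gg * (2:ℝ) ^ (s * j) *
          (2:ℝ) ^ ((s - 1) * n) := by ring
      _ ≤ _ := by gcongr; exact le_add_of_nonneg_left (by positivity)

lemma full_est (hφ : IsDyadicBump φ) (hs : 0 < s) (p : ℝ≥0∞) (hp : 1 ≤ p) :
    ∃ C, 0 ≤ C ∧ ∀ (D : CData d s) (j : ℤ),
      eLpNorm (BT (fun z => ∑ i, Wi φ D j i z)) p volume ≤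
        ENNReal.ofReal (C * D.Gf * (2:ℝ) ^ (s * j)) * ∑ k ∈ Finset.Icc (-4) 4, nb φ p D.b (j + k) +
        ∑' n : ℕ, ENNReal.ofReal (C * D.Gg * (2:ℝ) ^ (s * j) * (2:ℝ) ^ ((s - 1) * n)) *
          ∑ i, nb φ p (D.a i) (j - 4 + n) := by
  choose C1 hC1 h1 using fun i => low_i (d := d) hφ s p hp i
  obtain ⟨C2, hC2, h2⟩ := term_all (d := d) hφ hs p hp
  obtain ⟨Cp, hCp, hpm⟩ := phi_isMul hφ
  obtain ⟨Cx, hCx, hx⟩ := chi_isMul hφ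
  have hT : 0 ≤ ∑ i, C1 i := Finset.sum_nonneg fun i _ => hC1 i
  refine ⟨∑ i, C1 i + C2, by positivity, fun D j => ?_⟩
  have hGf := D.Gf0
  have hGg := D.Gg0
  have hW : Integrable (fun z => ∑ i, Wi φ D j i z) (volume.prod volume) :=
    integrable_finsetSum _ fun i _ => Wi_int hφ D j i
  have hc := cut_int hx ((2:ℝ) ^ (-(j - 4))) hW
  have hcc := hW.sub hc
  set Wh : EV d × EV d → ℂ := fun z => ((1 - chi φ ((2:ℝ) ^ (-(j - 4)) • z.1) : ℝ) : ℂ) *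
    ∑ i, Wi φ D j i z with hWh
  have hWhi : Integrable Wh (volume.prod volume) := by
    refine hcc.congr ?_
    filter_upwards with z
    simp only [hWh, Pi.sub_apply]; push_cast; ring
  have split : BT (fun z => ∑ i, Wi φ D j i z) = BT (fun z => ∑ i,
      ((chi φ ((2:ℝ) ^ (-(j - 4)) • z.1) : ℝ) : ℂ) * Wi φ D j i z) + BT Wh := by
    ext x
    rw [Pi.add_apply]
    have := PH_add (V := EV d) (h := fun z => z.1 + z.2) meas_add hc hWhi x
    unfold BT
    simp only [← Finset.mul_sum]
    rw [← this]
    congr 1; ext z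
    simp only [hWh]; push_cast; ring
  have hlow : Integrable (fun z => ∑ i,
      ((chi φ ((2:ℝ) ^ (-(j - 4)) • z.1) : ℝ) : ℂ) * Wi φ D j i z) (volume.prod volume) := by
    simpa only [← Finset.mul_sum] using hc
  have H : ∀ x, HasSum (fun n : ℕ => BT (fun z => ∑ i,
      ((φ ((2:ℝ) ^ (-(j - 4 + n)) • z.1) : ℝ) : ℂ) * Wi φ D j i z) x) (BT Wh x) := by
    intro x
    refine PH_hasSum (V := EV d) (h := fun z => z.1 + z.2) meas_add (W := fun (n : ℕ) z => ∑ i,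
      ((φ ((2:ℝ) ^ (-(j - 4 + n)) • z.1) : ℝ) : ℂ) * Wi φ D j i z)
      (fun n => (integrable_finsetSum _ fun i _ => cut_int hpm _ (Wi_int hφ D j i)).1)
      (fun n z => φ ((2:ℝ) ^ (-(j - 4 + n)) • z.1) * ‖∑ i, Wi φ D j i z‖)
      (fun z => (1 - chi φ ((2:ℝ) ^ (-(j - 4)) • z.1)) * ‖∑ i, Wi φ D j i z‖) ?_ ?_ ?_ ?_ x
    · refine hW.norm.bdd_mul (c := 1 + Cx) ?_ ?_
      · have := (Complex.continuous_re.comp hx.continuous)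
        simp only [Function.comp_def, Complex.ofReal_re] at this
        exact (continuous_const.sub (this.comp (by fun_prop))).aestronglyMeasurable
      · filter_upwards with z
        have := hx.bdd ((2:ℝ) ^ (-(j - 4)) • z.1)
        rw [Complex.norm_real] at this
        refine (norm_sub_le _ _).trans ?_
        rw [norm_one]; linarith
    · intro z
      exact (hasSum_up hφ (j - 4) z.1).mul_right _
    · intro n z
      rw [← Finset.mul_sum, norm_mul, Complex.norm_real, Real.norm_of_nonneg (hφ.nonneg _)]
    · intro z
      simp only [← Finset.mul_sum]
      exact (Complex.hasSum_ofReal.2 (hasSum_up hφ (j - 4) z.1)).mul_right _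
  have hcont : ∀ n : ℕ, Continuous (BT (fun z => ∑ i,
      ((φ ((2:ℝ) ^ (-(j - 4 + n)) • z.1) : ℝ) : ℂ) * Wi φ D j i z)) := fun n =>
    BT_cont (integrable_finsetSum _ fun i _ => cut_int hpm _ (Wi_int hφ D j i))
  have hhigh : eLpNorm (BT Wh) p volume ≤ ∑' n : ℕ, eLpNorm (BT (fun z => ∑ i,
      ((φ ((2:ℝ) ^ (-(j - 4 + n)) • z.1) : ℝ) : ℂ) * Wi φ D j i z)) p volume := by
    have := eLpNorm_tsum_le' (volume : Measure (EV d)) (fun n x => ‖BT (fun z => ∑ i,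
      ((φ ((2:ℝ) ^ (-(j - 4 + (n:ℕ))) • z.1) : ℝ) : ℂ) * Wi φ D j i z) x‖ₑ)
      (fun n => (hcont n).measurable.enorm) p hp
    refine le_trans ?_ (this.trans (le_of_eq ?_))
    · apply eLpNorm_mono_enorm
      intro x
      rw [← (H x).tsum_eq, enorm_eq_self]
      exact enorm_tsum_le_tsum_enorm
    · congr 1
  rw [split]
  refine (eLpNorm_add_le (BT_cont hlow).aestronglyMeasurable
    (BT_cont hWhi).aestronglyMeasurable hp).trans (add_le_add ?_ ?_)
  · refine (eL_BT_sum _ (fun i _ => (h1 i D j).1) hp).trans ?_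
    refine (Finset.sum_le_sum fun i _ => (h1 i D j).2).trans ?_
    rw [← Finset.sum_mul, ← ENNReal.ofReal_sum_of_nonneg
      (fun i _ => mul_nonneg (mul_nonneg (hC1 i) hGf) (by positivity))]
    gcongr ?_ * _
    apply ENNReal.ofReal_le_ofReal
    rw [← Finset.sum_mul, ← Finset.sum_mul]
    gcongr
    linarith
  · refine hhigh.trans (ENNReal.tsum_le_tsum fun n => (h2 D j n).trans ?_)
    gcongr ?_ * _
    apply ENNReal.ofReal_le_ofReal
    gcongr
    linarith

end comb

open MeasureTheory Real FourierTransform ENNReal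
open scoped ContDiff

section seqs

/-- `ℓ^r` norm over `ℤ`. -/
noncomputable def sN (r : ℝ≥0∞) (X : ℤ → ℝ≥0∞) : ℝ≥0∞ := eLpNorm X r Measure.count

lemma seq_eq {r : ℝ≥0∞} (hr : 1 ≤ r) (X : ℤ → ℝ≥0∞) :
    (if r = ⊤ then ⨆ j, X j else (∑' j, X j ^ r.toReal) ^ (1 / r.toReal)) = sN r X := by
  unfold sN
  split_ifs with h
  · rw [h, eLpNorm_exponent_top, eLpNormEssSup]
    simp [essSup_count]
  · rw [eLpNorm_eq_lintegral_rpow_enorm_toReal (by positivity) h, lintegral_count]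
    simp

lemma sN_mono {r : ℝ≥0∞} {X Y : ℤ → ℝ≥0∞} (h : ∀ j, X j ≤ Y j) : sN r X ≤ sN r Y := by
  apply eLpNorm_mono_enorm
  intro j; simpa using h j

lemma sN_shift {r : ℝ≥0∞} (hr : 1 ≤ r) (X : ℤ → ℝ≥0∞) (m : ℤ) :
    sN r (fun j => X (j + m)) = sN r X := by
  rw [← seq_eq hr, ← seq_eq hr]
  split_ifs with h
  · exact (Equiv.addRight m).iSup_comp (g := X)
  · congr 1
    exact (Equiv.addRight m).tsum_eq (fun j => X j ^ r.toReal)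

lemma sN_conv {r : ℝ≥0∞} (hr : 1 ≤ r) {ι : Type*} [Countable ι] [MeasurableSpace ι]
    [MeasurableSingletonClass ι] (w : ι → ℝ≥0∞) (F : ι → ℤ → ℝ≥0∞) (B : ℝ≥0∞)
    (hB : ∀ n, sN r (F n) ≤ B) : sN r (fun j => ∑' n, w n * F n j) ≤ (∑' n, w n) * B := by
  have := mink (Measure.count : Measure ℤ) (Measure.count : Measure ι) w
    (measurable_of_countable _) F (measurable_of_countable _) r hr B hB
  simp only [lintegral_count] at this
  exact this

lemma sN_add {r : ℝ≥0∞} (hr : 1 ≤ r) (X Y : ℤ → ℝ≥0∞) :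
    sN r (fun j => X j + Y j) ≤ sN r X + sN r Y :=
  eLpNorm_add_le (measurable_of_countable X).aestronglyMeasurable
    (measurable_of_countable Y).aestronglyMeasurable hr

lemma sN_sum {r : ℝ≥0∞} (hr : 1 ≤ r) {ι : Type*} (S : Finset ι) (X : ι → ℤ → ℝ≥0∞) :
    sN r (fun j => ∑ i ∈ S, X i j) ≤ ∑ i ∈ S, sN r (X i) := by
  classical
  induction S using Finset.induction_on with
  | empty => simp [sN]
  | insert a S ha ih =>
    simp only [Finset.sum_insert ha]
    exact (sN_add hr _ _).trans (add_le_add le_rfl ih)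

lemma sN_mul {r : ℝ≥0∞} (hr : 1 ≤ r) (A : ℝ≥0∞) (X : ℤ → ℝ≥0∞) :
    sN r (fun j => A * X j) ≤ A * sN r X := by
  have := sN_conv hr (ι := Unit) (fun _ => A) (fun _ => X) (sN r X) (fun _ => le_rfl)
  simpa using this

lemma seq_est {r : ℝ≥0∞} (hr : 1 ≤ r) {ι : Type*} (S : Finset ι) (X c : ℤ → ℝ≥0∞)
    (D : ι → ℤ → ℝ≥0∞) (A B : ℝ≥0∞) (w : ℕ → ℝ≥0∞)
    (hX : ∀ j, X j ≤ A * ∑ k ∈ Finset.Icc (-4 : ℤ) 4, c (j + k) +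
      B * ∑' n : ℕ, w n * ∑ i ∈ S, D i (j - 4 + n)) :
    sN r X ≤ A * (9 * sN r c) + B * ((∑' n, w n) * ∑ i ∈ S, sN r (D i)) := by
  refine (sN_mono hX).trans ((sN_add hr _ _).trans (add_le_add ?_ ?_))
  · refine (sN_mul hr _ _).trans (mul_le_mul_right ?_ _)
    refine (sN_sum hr _ _).trans ?_
    simp only [sN_shift hr]
    simp
  · refine (sN_mul hr _ _).trans (mul_le_mul_right ?_ _)
    refine sN_conv hr w (fun n j => ∑ i ∈ S, D i (j - 4 + n)) _ fun n => ?_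
    refine (sN_sum hr _ _).trans (Finset.sum_le_sum fun i _ => le_of_eq ?_)
    rw [← sN_shift hr (D i) (-4 + n)]
    congr 1; ext j; congr 1; ring

end seqs

open MeasureTheory Real FourierTransform ENNReal
open scoped ContDiff

section schw
variable {d : ℕ}

/-- Complexified component of a Schwartz vector field. -/
noncomputable def fc (f : SchwartzMap (EV d) (EV d)) (i : Fin d) : SchwartzMap (EV d) ℂ :=
  f.postcompCLM (Complex.ofRealCLM ∘L (EuclideanSpace.proj i : EV d →L[ℝ] ℝ))

lemma fc_apply (f : SchwartzMap (EV d) (EV d)) (i : Fin d) (x : EV d) :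
    fc f i x = ((f x i : ℝ) : ℂ) := rfl

/-- Partial derivative of a Schwartz function. -/
noncomputable def dS (i : Fin d) (g : SchwartzMap (EV d) ℂ) : SchwartzMap (EV d) ℂ :=
  SchwartzMap.evalCLM ℝ (EV d) ℂ (EuclideanSpace.single i 1) (SchwartzMap.fderivCLM ℝ (EV d) ℂ g)

lemma dS_apply (i : Fin d) (g : SchwartzMap (EV d) ℂ) (x : EV d) :
    dS i g x = fderiv ℝ (fun z => g z) x (EuclideanSpace.single i 1) := rfl

lemma fourier_dS (i : Fin d) (g : SchwartzMap (EV d) ℂ) (ξ : EV d) :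
    𝓕 (dS i g : EV d → ℂ) ξ = (2 * π * Complex.I) * ((ξ i : ℂ) * 𝓕 (g : EV d → ℂ) ξ) := by
  have h := SchwartzMap.fourier_lineDerivOp_eq g (EuclideanSpace.single i (1:ℝ))
  have h2 := congrArg (fun u : SchwartzMap (EV d) ℂ => u ξ) h
  have ht : (fun x : EV d => inner ℝ x (EuclideanSpace.single i (1:ℝ))).HasTemperateGrowth := by
    fun_prop
  simp only [_root_.smul_apply, SchwartzMap.smulLeftCLM_apply ht] at h2
  have h3 : inner ℝ ξ (EuclideanSpace.single i (1:ℝ)) = ξ i := by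
    rw [real_inner_comm, EuclideanSpace.inner_single_left]; simp
  rw [h3] at h2
  exact h2

lemma schw_int (u : SchwartzMap (EV d) ℂ) {s : ℝ} (hs : 0 ≤ s) :
    Integrable (fun ζ : EV d => ((‖ζ‖ ^ s : ℝ) : ℂ) * u ζ) := by
  refine (u.integrable.norm.add (u.integrable_pow_mul volume ⌈s⌉₊)).mono' ?_ ?_
  · refine Continuous.aestronglyMeasurable ?_
    have := u.continuous
    have h2 : Continuous (fun ζ : EV d => ‖ζ‖ ^ s) :=
      continuous_norm.rpow_const (fun _ => Or.inr hs)
    fun_prop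
  · filter_upwards with ζ
    have h0 : 0 ≤ ‖ζ‖ ^ s := by positivity
    rw [norm_mul, Complex.norm_real, Real.norm_of_nonneg h0, Pi.add_apply]
    have : ‖ζ‖ ^ s ≤ 1 + ‖ζ‖ ^ ⌈s⌉₊ := by
      rcases le_total ‖ζ‖ 1 with h | h
      · have := Real.rpow_le_one (norm_nonneg ζ) h hs
        have : 0 ≤ ‖ζ‖ ^ ⌈s⌉₊ := by positivity
        linarith
      · have := Real.rpow_le_rpow_of_exponent_le h (Nat.le_ceil s)
        rw [Real.rpow_natCast] at this
        linarith
    nlinarith [norm_nonneg (u ζ)]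

lemma inv_fourier (u : SchwartzMap (EV d) ℂ) : 𝓕⁻ (𝓕 (u : EV d → ℂ)) = u := by
  rw [← SchwartzMap.fourier_coe, ← SchwartzMap.fourierInv_coe,
    FourierTransform.fourierInv_fourier_eq]

/-- coordinate-weighted Fourier transform as a Schwartz function. -/
lemma coord_fourier (i : Fin d) (g : SchwartzMap (EV d) ℂ) :
    (fun ζ : EV d => (ζ i : ℂ) * 𝓕 (g : EV d → ℂ) ζ)
      = ⇑((2 * π * Complex.I)⁻¹ • 𝓕 (dS i g)) := by
  ext ζ
  rw [_root_.smul_apply, SchwartzMap.fourier_coe, fourier_dS, smul_eq_mul]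
  have : (2 * π * Complex.I) ≠ 0 := by simp [Real.pi_ne_zero]
  field_simp

lemma fInv_coord (i : Fin d) (g : SchwartzMap (EV d) ℂ) (x : EV d) :
    𝓕⁻ (fun ζ : EV d => (ζ i : ℂ) * 𝓕 (g : EV d → ℂ) ζ) x = (2 * π * Complex.I)⁻¹ * dS i g x := by
  rw [coord_fourier]
  have := fInv_cmul (2 * π * Complex.I)⁻¹ (𝓕 (dS i g : EV d → ℂ))
  have h2 := congrFun this x
  rw [inv_fourier] at h2
  exact h2

lemma fderiv_fInv {a : EV d → ℂ} (ha : Integrable a) (hda : Integrable (fun v => ‖v‖ * ‖a v‖))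
    (i : Fin d) (x : EV d) :
    fderiv ℝ (𝓕⁻ a) x (EuclideanSpace.single i 1)
      = 𝓕⁻ (fun ζ : EV d => (2 * π * Complex.I) * ((ζ i : ℂ) * a ζ)) x := by
  rw [Real.fourierInv_eq_fourier_comp_neg, Real.fourierInv_eq_fourier_comp_neg]
  have h1 : Integrable (fun v => a (-v)) := ha.comp_neg
  have h2 : Integrable (fun v => ‖v‖ * ‖a (-v)‖) := by
    have := hda.comp_neg; simpa using this
  rw [Real.fderiv_fourier h1 h2, Real.fourier_continuousLinearMap_apply]
  · refine congrArg (fun F : EV d → ℂ => 𝓕 F x) (funext fun v => ?_)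
    rw [VectorFourier.fourierSMulRight_apply]
    have h3 : innerSL ℝ v (EuclideanSpace.single i (1:ℝ)) = v i := by
      rw [innerSL_apply_apply, real_inner_comm, EuclideanSpace.inner_single_left]; simp
    rw [h3]
    simp
  · refine (h2.const_mul (2 * π * ‖(innerSL ℝ : EV d →L[ℝ] EV d →L[ℝ] ℝ)‖)).mono' ?_ ?_
    · exact h1.aestronglyMeasurable.fourierSMulRight
    · filter_upwards with v
      refine (VectorFourier.norm_fourierSMulRight_le _ _ _).trans (le_of_eq ?_)
      ring

lemma le_essSup {F : Type*} [NormedAddCommGroup F] (u : EV d → F) (hu : Continuous u)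
    (B : ℝ) (hB : ∀ x, ‖u x‖ ≤ B) :
    eLpNorm u ⊤ volume ≠ ⊤ ∧ ∀ x, ‖u x‖ ≤ (eLpNorm u ⊤ volume).toReal := by
  have h1 : eLpNorm u ⊤ volume ≠ ⊤ := by
    refine ne_top_of_le_ne_top (ENNReal.ofReal_ne_top (r := B)) ?_
    rw [eLpNorm_exponent_top]
    exact eLpNormEssSup_le_of_ae_bound (by filter_upwards with x; exact hB x)
  refine ⟨h1, ?_⟩
  have h2 : ∀ᵐ x, ‖u x‖ ≤ (eLpNorm u ⊤ volume).toReal := by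
    have := ae_le_eLpNormEssSup (f := u) (μ := (volume : Measure (EV d)))
    rw [← eLpNorm_exponent_top] at this
    filter_upwards [this] with x hx
    have := ENNReal.toReal_mono h1 hx
    simpa using this
  have h3 := Measure.dense_of_ae h2
  intro x
  exact (isClosed_le (by fun_prop) continuous_const).closure_subset_iff.2 (fun y hy => hy) (h3 x)

lemma schw_fderiv {F : Type*} [NormedAddCommGroup F] [NormedSpace ℝ F] (u : SchwartzMap (EV d) F) :
    eLpNorm (fun x => fderiv ℝ (fun y => u y) x) ⊤ volume ≠ ⊤ ∧ ∀ x, ‖fderiv ℝ (fun y => u y) x‖ ≤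
      (eLpNorm (fun x => fderiv ℝ (fun y => u y) x) ⊤ volume).toReal := by
  obtain ⟨C, hC0, hC⟩ := u.decay 0 1
  refine le_essSup _ ?_ C ?_
  · exact (u.smooth 1).continuous_fderiv (by norm_num)
  · intro x
    have := hC x
    rw [norm_iteratedFDeriv_one] at this
    simpa using this

end schw

open MeasureTheory Real FourierTransform ENNReal
open scoped ContDiff

section ident
variable {d : ℕ} {φ : EV d → ℝ}

lemma div_fourier (f : SchwartzMap (EV d) (EV d))
    (hdiv : ∀ x, (∑ i : Fin d, fderiv ℝ (fun y => f y i) x (EuclideanSpace.single i 1)) = 0)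
    (ξ : EV d) : ∑ i, (ξ i : ℂ) * 𝓕 (fc f i : EV d → ℂ) ξ = 0 := by
  have h1 : ∑ i, 𝓕 (dS i (fc f i) : EV d → ℂ) ξ = 0 := by
    simp only [fF_eq]
    rw [← integral_finsetSum]
    · simp only [← Finset.mul_sum]
      have : ∀ x, ∑ i, dS i (fc f i) x = 0 := by
        intro x
        have h2 : ∀ i, dS i (fc f i) x =
            ((fderiv ℝ (fun y => f y i) x (EuclideanSpace.single i 1) : ℝ) : ℂ) := by
          intro i
          rw [dS_apply]
          have hd : DifferentiableAt ℝ (fun y => f y i) x := by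
            have := f.differentiable x
            exact ((EuclideanSpace.proj i : EV d →L[ℝ] ℝ).differentiableAt).comp x this
          have := (Complex.ofRealCLM.hasFDerivAt.comp x hd.hasFDerivAt).fderiv
          have h3 := congrArg (fun L : EV d →L[ℝ] ℂ => L (EuclideanSpace.single i 1)) this
          exact h3
        simp only [h2]
        rw [← Complex.ofReal_sum, hdiv]; simp
      simp [this]
    · intro i _
      refine (dS i (fc f i)).integrable.bdd_mul (c := 1) ?_ ?_
      · exact Continuous.aestronglyMeasurable (by fun_prop)
      · filter_upwards with x; simp [norm_ch]
  simp only [fourier_dS] at h1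
  rw [← Finset.mul_sum] at h1
  have : (2 * π * Complex.I) ≠ 0 := by simp [Real.pi_ne_zero]
  exact (mul_eq_zero.1 h1).resolve_left this

/-- The data attached to `f`, `g`. -/
noncomputable def mkD (s : ℝ) (hs : 0 ≤ s) (f : SchwartzMap (EV d) (EV d)) (g : SchwartzMap (EV d) ℂ)
    (hdiv : ∀ x, (∑ i : Fin d, fderiv ℝ (fun y => f y i) x (EuclideanSpace.single i 1)) = 0) :
    CData d s where
  a i := 𝓕 (fc f i : EV d → ℂ)
  b := 𝓕 (g : EV d → ℂ)
  Gf := (eLpNorm (fun x => fderiv ℝ (fun y => f y) x) ⊤ volume).toReal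
  Gg := (eLpNorm (fun x => fderiv ℝ (fun y => g y) x) ⊤ volume).toReal
  Gf0 := ENNReal.toReal_nonneg
  Gg0 := ENNReal.toReal_nonneg
  ha i := (𝓕 (fc f i)).integrable
  hb := (𝓕 g).integrable
  hbi i := by rw [coord_fourier]; exact SchwartzMap.integrable _
  hbs := schw_int (𝓕 g) hs
  hbsi i := by
    have := schw_int ((2 * π * Complex.I)⁻¹ • 𝓕 (dS i g)) hs
    rw [← coord_fourier] at this
    exact this
  hdiv := div_fourier f hdiv
  hf i x y := by
    rw [inv_fourier, fc_apply, fc_apply, ← Complex.ofReal_sub, Complex.norm_real]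
    have h1 := Convex.norm_image_sub_le_of_norm_fderiv_le (𝕜 := ℝ) (f := fun y => f y)
      (fun x _ => f.differentiable x) (fun x _ => (schw_fderiv f).2 x) convex_univ
      (Set.mem_univ y) (Set.mem_univ x)
    refine le_trans ?_ h1
    have := EuclideanSpace.norm_eq (f x - f y)
    exact PiLp.norm_apply_le (f x - f y) i
  hg i x := by
    rw [fInv_coord, norm_mul]
    have h1 : ‖dS i g x‖ ≤ (eLpNorm (fun x => fderiv ℝ (fun y => g y) x) ⊤ volume).toReal := by
      rw [dS_apply]
      refine (ContinuousLinearMap.le_opNorm _ _).trans ?_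
      have := (schw_fderiv g).2 x
      simpa using this
    have h2 : ‖(2 * π * Complex.I)⁻¹‖ ≤ 1 := by
      rw [norm_inv]
      apply inv_le_one_of_one_le₀
      simp [abs_of_pos Real.pi_pos]
      have := Real.pi_gt_three
      linarith
    calc _ ≤ 1 * ‖dS i g x‖ := by gcongr
      _ ≤ _ := by rw [one_mul]; exact h1

/-- The commutator. -/
noncomputable def cmt (s : ℝ) (f : SchwartzMap (EV d) (EV d)) (g : SchwartzMap (EV d) ℂ) :
    EV d → ℂ := fun x =>
            fracLap s (fun y => ∑ j : Fin d,
              (f y j : ℂ) * fderiv ℝ (fun z => g z) y (EuclideanSpace.single j 1)) x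
            - ∑ j : Fin d, (f x j : ℂ) *
                fderiv ℝ (fracLap s (fun z => g z)) x (EuclideanSpace.single j 1)

/-- `f·∇g` as a Schwartz function. -/
noncomputable def HS (f : SchwartzMap (EV d) (EV d)) (g : SchwartzMap (EV d) ℂ) :
    SchwartzMap (EV d) ℂ :=
  ∑ i, SchwartzMap.pairing (ContinuousLinearMap.mul ℂ ℂ) (fc f i) (dS i g)

lemma HS_apply (f : SchwartzMap (EV d) (EV d)) (g : SchwartzMap (EV d) ℂ) (x : EV d) :
    HS f g x = ∑ i, fc f i x * dS i g x := by
  unfold HS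
  rw [_root_.sum_apply]
  rfl

lemma comm_eq {s : ℝ} (hs : 0 ≤ s) (f : SchwartzMap (EV d) (EV d)) (g : SchwartzMap (EV d) ℂ)
    (hdiv : ∀ x, (∑ i : Fin d, fderiv ℝ (fun y => f y i) x (EuclideanSpace.single i 1)) = 0)
    (x : EV d) :
    cmt s f g x = 𝓕⁻ (fun ξ => ((‖ξ‖ ^ s : ℝ) : ℂ) * 𝓕 (HS f g : EV d → ℂ) ξ) x -
      ∑ i, 𝓕⁻ ((mkD s hs f g hdiv).a i) x *
        𝓕⁻ (fun ζ : EV d => (2 * π * Complex.I) *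
          (((‖ζ‖ ^ s : ℝ) : ℂ) * ((ζ i : ℂ) * (mkD s hs f g hdiv).b ζ))) x := by
  unfold cmt
  congr 1
  · have : (fun y => ∑ j : Fin d,
      (f y j : ℂ) * fderiv ℝ (fun z => g z) y (EuclideanSpace.single j 1)) = HS f g := by
      ext y; rw [HS_apply]; rfl
    rw [this]; rfl
  · refine Finset.sum_congr rfl fun i _ => ?_
    congr 1
    · change _ = 𝓕⁻ (𝓕 (fc f i : EV d → ℂ)) x
      rw [inv_fourier]; rfl
    · unfold fracLap
      rw [fderiv_fInv]
      · refine congrArg (fun F : EV d → ℂ => 𝓕⁻ F x) (funext fun v => ?_)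
        change _ = (2 * π * Complex.I) * (((‖v‖ ^ s : ℝ) : ℂ) * ((v i : ℂ) * 𝓕 (g : EV d → ℂ) v))
        ring
      · exact schw_int (𝓕 g) hs
      · have := (schw_int (𝓕 g) (s := 1 + s) (by linarith)).norm
        refine this.congr ?_
        filter_upwards with v
        rw [norm_mul, norm_mul, ← mul_assoc]
        congr 1
        rw [Complex.norm_real, Complex.norm_real, Real.norm_of_nonneg (by positivity),
          Real.norm_of_nonneg (by positivity)]
        rw [Real.rpow_add_of_nonneg (norm_nonneg v) (by norm_num) hs, Real.rpow_one]

lemma ann_sc (hφ : IsDyadicBump φ) (j : ℤ) : Ann (fun ξ => φ ((2:ℝ) ^ (-j) • ξ)) where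
  smooth := hφ.smooth.comp (contDiff_const_smul _)
  supp := ⟨3/4 * (2:ℝ) ^ j, 8/3 * (2:ℝ) ^ j, by positivity, fun _ h => phi_supp hφ h⟩

lemma conv_split (K : SchwartzMap (EV d) ℂ) {ι : Type*} (S : Finset ι) (u : EV d → ℂ)
    (v : ι → EV d → ℂ) (hu : Continuous u) (hv : ∀ i, Continuous (v i))
    (hub : ∃ B, ∀ x, ‖u x‖ ≤ B) (hvb : ∀ i, ∃ B, ∀ x, ‖v i x‖ ≤ B) (x : EV d) :
    ∫ y, K y * (u (x - y) - ∑ i ∈ S, v i (x - y)) =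
      (∫ y, K y * u (x - y)) - ∑ i ∈ S, ∫ y, K y * v i (x - y) := by
  have key : ∀ w : EV d → ℂ, Continuous w → (∃ B, ∀ x, ‖w x‖ ≤ B) →
      Integrable (fun y => K y * w (x - y)) := by
    rintro w hw ⟨B, hB⟩
    refine K.integrable.mul_bdd (c := B) ?_ ?_
    · exact Continuous.aestronglyMeasurable (by fun_prop)
    · filter_upwards with y; exact hB _
  rw [← integral_finsetSum _ (fun i _ => key _ (hv i) (hvb i)), ← integral_sub (key u hu hub)
    (integrable_finsetSum _ (fun i _ => key _ (hv i) (hvb i)))]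
  congr 1; ext y; rw [mul_sub, Finset.mul_sum]

lemma block_comm (hφ : IsDyadicBump φ) {s : ℝ} (hs : 0 ≤ s) (f : SchwartzMap (EV d) (EV d))
    (g : SchwartzMap (EV d) ℂ)
    (hdiv : ∀ x, (∑ i : Fin d, fderiv ℝ (fun y => f y i) x (EuclideanSpace.single i 1)) = 0)
    (hR : Integrable (cmt s f g)) (j : ℤ) :
    lpBlock φ j (cmt s f g) = fun x => (2 * π * Complex.I) *
      BT (fun z => ∑ i, Wi φ (mkD s hs f g hdiv) j i z) x := by
  ext x
  set D := mkD s hs f g hdiv with hD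
  obtain ⟨C1, -, h1⟩ := (ann_sc hφ j).isMul 0 (P := fun _ => 1) contDiff_const
  obtain ⟨C2, -, h2⟩ := (ann_sc hφ j).isMul s (P := fun _ => 1) contDiff_const
  have e1 : mu (fun ξ => φ ((2:ℝ) ^ (-j) • ξ)) 0 (fun _ => 1)
      = fun ξ : EV d => ((φ ((2:ℝ) ^ (-j) • ξ) : ℝ) : ℂ) := by
    ext ξ; simp [mu]
  have e2 : mu (fun ξ => φ ((2:ℝ) ^ (-j) • ξ)) s (fun _ => 1)
      = fun ξ : EV d => ((φ ((2:ℝ) ^ (-j) • ξ) : ℝ) : ℂ) * ((‖ξ‖ ^ s : ℝ) : ℂ) := by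
    ext ξ; simp [mu]
  rw [e1] at h1
  rw [e2] at h2
  have p1 := fun i => prod_int h1 1 (D.ha i) (((D.hbsi i).const_mul (2 * π * Complex.I)))
  have p2 := fun i => prod_int h2 1 (D.ha i) ((D.hbi i).const_mul (2 * π * Complex.I))
  obtain ⟨K1, hK1, -, -⟩ := h1
  obtain ⟨K2, hK2, -, -⟩ := h2
  have i1 : Integrable (fun ξ : EV d => ((φ ((2:ℝ) ^ (-j) • ξ) : ℝ) : ℂ)) := by
    rw [← hK1]; exact (𝓕 K1).integrable
  have i2 : Integrable (fun ξ : EV d => ((φ ((2:ℝ) ^ (-j) • ξ) : ℝ) : ℂ) * ((‖ξ‖ ^ s : ℝ) : ℂ)) := by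
    rw [← hK2]; exact (𝓕 K2).integrable
  have hHi : Integrable (fun ξ : EV d => ((‖ξ‖ ^ s : ℝ) : ℂ) * 𝓕 (HS f g : EV d → ℂ) ξ) := schw_int (𝓕 (HS f g)) hs
  have hcs := fun i => (D.hbsi i).const_mul (2 * π * Complex.I)
  have hc := fun i => (D.hbi i).const_mul (2 * π * Complex.I)
  -- first term
  have t1 : 𝓕⁻ (fun ξ => ((φ ((2:ℝ) ^ (-j) • ξ) : ℝ) : ℂ) *
        (((‖ξ‖ ^ s : ℝ) : ℂ) * 𝓕 (HS f g : EV d → ℂ) ξ)) x =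
      ∑ i, BT (fun z => (((φ ((2:ℝ) ^ (-j) • ((1:ℝ) • (z.1 + z.2))) : ℝ) : ℂ) *
        ((‖(1:ℝ) • (z.1 + z.2)‖ ^ s : ℝ) : ℂ)) *
          (D.a i z.1 * ((2 * π * Complex.I) * ((z.2 i : ℂ) * D.b z.2)))) x := by
    have := mult_eq_conv (HS f g).integrable i2 x
    simp only [mul_assoc] at this ⊢
    rw [this]
    have hK : 𝓕⁻ (fun ξ : EV d => ((φ ((2:ℝ) ^ (-j) • ξ) : ℝ) : ℂ) * ((‖ξ‖ ^ s : ℝ) : ℂ)) = K2 := by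
      rw [← hK2, inv_fourier]
    rw [hK]
    have hh : ∀ y, HS f g y = 0 - ∑ i, -(fc f i y * dS i g y) := by
      intro y; rw [HS_apply]; simp
    simp only [hh]
    rw [conv_split K2 Finset.univ (fun _ => 0) (fun i y => -(fc f i y * dS i g y)) continuous_const
      (fun i => ((fc f i).continuous.mul (dS i g).continuous).neg) ⟨0, by simp⟩]
    · simp only [mul_zero, integral_zero, zero_sub, ← Finset.sum_neg_distrib, mul_neg, integral_neg,
        neg_neg]
      refine Finset.sum_congr rfl fun i _ => ?_
      have h3 := conv_BT (D.ha i) (hc i) K2.integrable 1 x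
      rw [hK2] at h3
      simp only [mul_assoc] at h3 ⊢
      rw [← h3]
      congr 1; ext y
      rw [one_smul]
      congr 2
      · change _ = 𝓕⁻ (𝓕 (fc f i : EV d → ℂ)) (x - y)
        rw [inv_fourier]
      · change _ = 𝓕⁻ (fun ξ : EV d => 2 * (π * (Complex.I * ((ξ i : ℂ) * 𝓕 (g : EV d → ℂ) ξ)))) (x - y)
        have : (fun ξ : EV d => 2 * (π * (Complex.I * ((ξ i : ℂ) * 𝓕 (g : EV d → ℂ) ξ))))
            = 𝓕 (dS i g : EV d → ℂ) := by
          ext ξ; rw [fourier_dS]; ring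
        rw [this, inv_fourier]
    · intro i
      obtain ⟨C, hC0, hC⟩ := (SchwartzMap.pairing (ContinuousLinearMap.mul ℂ ℂ) (fc f i) (dS i g)).decay 0 0
      refine ⟨C, fun y => ?_⟩
      have := hC y
      rw [norm_neg]
      simpa using this
  have t2 := fun i => conv_BT (D.ha i) (hcs i) K1.integrable 1 x
  have hK : 𝓕⁻ (fun ξ : EV d => ((φ ((2:ℝ) ^ (-j) • ξ) : ℝ) : ℂ)) = K1 := by
    rw [← hK1, inv_fourier]
  have t3 := conv_fInv hHi K1.integrable 1 x
  rw [hK1] at t2 t3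
  simp only [one_smul] at t2 t3 t1 p1 p2
  unfold lpBlock
  rw [mult_eq_conv hR i1, hK]
  have hce := comm_eq hs f g hdiv
  rw [← hD] at hce
  simp only [hce]
  rw [conv_split K1 Finset.univ _ (fun i y => 𝓕⁻ (D.a i) y *
        𝓕⁻ (fun ζ : EV d => (2 * π * Complex.I) *
          (((‖ζ‖ ^ s : ℝ) : ℂ) * ((ζ i : ℂ) * D.b ζ))) y) (fInv_continuous hHi)
    (fun i => (fInv_continuous (D.ha i)).mul (fInv_continuous (hcs i))) ⟨_, fInv_bdd hHi⟩]
  · refine (congrArg₂ (· - ·) (t3.trans t1) (Finset.sum_congr rfl fun i _ => t2 i)).trans ?_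
    have hsub : ∀ i, Integrable (fun z => (2 * π * Complex.I) * Wi φ D j i z) (volume.prod volume) :=
      fun i => (Wi_int hφ D j i).const_mul _
    have hfin : (2 * π * Complex.I) * BT (fun z => ∑ i, Wi φ D j i z) x
        = ∑ i, BT (fun z => (2 * π * Complex.I) * Wi φ D j i z) x := by
      have h5 := congrFun (BT_cmul (2 * π * Complex.I) (fun z => ∑ i, Wi φ D j i z)) x
      rw [← h5]
      simp only [Finset.mul_sum]
      exact PH_sum meas_add Finset.univ (fun i _ => hsub i) x
    rw [hfin]
    change _ - _ = _
    rw [← Finset.sum_sub_distrib]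
    refine Finset.sum_congr rfl fun i _ => ?_
    refine (PH_sub meas_add (p2 i) (p1 i) x).symm.trans ?_
    refine congrArg (fun W => BT W x) (funext fun z => ?_)
    unfold Wi
    ring
  · intro i
    refine ⟨(∫ ξ, ‖D.a i ξ‖) * ∫ ζ : EV d, ‖(2 * π * Complex.I) *
      (((‖ζ‖ ^ s : ℝ) : ℂ) * ((ζ i : ℂ) * D.b ζ))‖, fun y => ?_⟩
    rw [norm_mul]
    exact mul_le_mul (fInv_bdd (D.ha i) y) (fInv_bdd (hcs i) y) (norm_nonneg _)
      ((norm_nonneg _).trans (fInv_bdd (D.ha i) y))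

end ident

open MeasureTheory Real FourierTransform ENNReal
open scoped ContDiff

section fin
variable {d : ℕ} {φ : EV d → ℝ}

lemma besov_eq {r : ℝ≥0∞} (hr : 1 ≤ r) (σ : ℝ) (p : ℝ≥0∞) (F : EV d → ℂ) :
    besovNorm φ σ p r F =
      sN r (fun j => ENNReal.ofReal ((2:ℝ) ^ (σ * j)) * eLpNorm (lpBlock φ j F) p volume) :=
  seq_eq hr _

lemma besov_nb {r : ℝ≥0∞} (hr : 1 ≤ r) (σ : ℝ) (p : ℝ≥0∞) (F : EV d → ℂ) :
    besovNorm φ σ p r F =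
      sN r (fun j : ℤ => ENNReal.ofReal ((2:ℝ) ^ (σ * j)) * nb φ p (𝓕 F) j) :=
  seq_eq hr _

lemma fourier_undef {R : EV d → ℂ} (hR : ¬ Integrable R) (ξ : EV d) : 𝓕 R ξ = 0 := by
  rw [fF_eq]
  apply integral_undef
  intro h
  apply hR
  have := h.bdd_mul (c := 1) (f := fun x => ch (inner ℝ x ξ))
    (Continuous.aestronglyMeasurable (by fun_prop)) (by filter_upwards with x; simp [norm_ch])
  refine this.congr ?_
  filter_upwards with x
  rw [← mul_assoc, ← ch_add]
  simp [ch]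

lemma block_undef {R : EV d → ℂ} (hR : ¬ Integrable R) (j : ℤ) : lpBlock φ j R = fun _ => 0 := by
  ext x
  unfold lpBlock
  simp only [fourier_undef hR, mul_zero]
  rw [fInv_eq]; simp

lemma besov_zero {r : ℝ≥0∞} (hr : 1 ≤ r) (σ : ℝ) (p : ℝ≥0∞) (F : EV d → ℂ)
    (h : ∀ j, lpBlock φ j F = fun _ => 0) : besovNorm φ σ p r F = 0 := by
  rw [besov_eq hr]
  simp only [h]
  simp [sN]

lemma e1_le (t x : ℝ) (k : ℝ) (hk : |k| ≤ 4) :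
    (2:ℝ) ^ (t * x) ≤ (2:ℝ) ^ (4 * |t|) * (2:ℝ) ^ (t * (x + k)) := by
  rw [two_rpow_mul]
  apply Real.rpow_le_rpow_of_exponent_le (by norm_num)
  have : |t * k| ≤ 4 * |t| := by
    rw [abs_mul]; nlinarith [abs_nonneg t]
  have := neg_abs_le (t * k)
  nlinarith

lemma e2_le (σ s x n : ℝ) :
    (2:ℝ) ^ (σ * x) * ((2:ℝ) ^ (s * x) * (2:ℝ) ^ ((s - 1) * n)) ≤
      (2:ℝ) ^ (4 * |σ + s|) * ((2:ℝ) ^ (-(σ + 1) * n) * (2:ℝ) ^ ((σ + s) * (x - 4 + n))) := by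
  simp only [two_rpow_mul]
  apply Real.rpow_le_rpow_of_exponent_le (by norm_num)
  have := le_abs_self (σ + s)
  nlinarith

lemma w_sum {σ : ℝ} (hσ : -1 < σ) :
    (∑' n : ℕ, ENNReal.ofReal ((2:ℝ) ^ (-(σ + 1) * n))) ≠ ⊤ := by
  have h1 : ∀ n : ℕ, (2:ℝ) ^ (-(σ + 1) * n) = ((2:ℝ) ^ (-(σ + 1))) ^ n := fun n => by
    rw [Real.rpow_mul (by norm_num), Real.rpow_natCast]
  simp only [h1]
  have h2 : (2:ℝ) ^ (-(σ + 1)) < 1 := Real.rpow_lt_one_of_one_lt_of_neg (by norm_num) (by linarith)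
  have hs := summable_geometric_of_lt_one (by positivity) h2
  rw [← ENNReal.ofReal_tsum_of_nonneg (fun n => by positivity) hs]
  exact ENNReal.ofReal_ne_top

lemma hX_est {s σ : ℝ} (p : ℝ≥0∞) {C : ℝ} (hC : 0 ≤ C) (D : CData d s) (j : ℤ) (E : ℝ≥0∞)
    (hE : E ≤ ENNReal.ofReal (C * D.Gf * (2:ℝ) ^ (s * j)) *
        ∑ k ∈ Finset.Icc (-4) 4, nb φ p D.b (j + k) +
        ∑' n : ℕ, ENNReal.ofReal (C * D.Gg * (2:ℝ) ^ (s * j) * (2:ℝ) ^ ((s - 1) * n)) *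
          ∑ i, nb φ p (D.a i) (j - 4 + n)) :
    ENNReal.ofReal ((2:ℝ) ^ (σ * j)) * E ≤
      ENNReal.ofReal (C * (2:ℝ) ^ (4 * |σ + s|) * D.Gf) * ∑ k ∈ Finset.Icc (-4 : ℤ) 4,
        (fun k : ℤ => ENNReal.ofReal ((2:ℝ) ^ ((σ + s) * k)) * nb φ p D.b k) (j + k) +
      ENNReal.ofReal (C * (2:ℝ) ^ (4 * |σ + s|) * D.Gg) *
        ∑' n : ℕ, ENNReal.ofReal ((2:ℝ) ^ (-(σ + 1) * n)) * ∑ i,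
        (fun (i : Fin d) (k : ℤ) => ENNReal.ofReal ((2:ℝ) ^ ((σ + s) * k)) * nb φ p (D.a i) k) i
          (j - 4 + n) := by
  have hf0 := D.Gf0
  have hg0 := D.Gg0
  refine (mul_le_mul_right hE _).trans ?_
  rw [mul_add]
  refine add_le_add ?_ ?_
  · rw [Finset.mul_sum, Finset.mul_sum, Finset.mul_sum]
    refine Finset.sum_le_sum fun k hk => ?_
    rw [Finset.mem_Icc] at hk
    rw [← mul_assoc, ← mul_assoc, ← ENNReal.ofReal_mul (by positivity),
      ← ENNReal.ofReal_mul (by positivity)]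
    refine mul_le_mul_left (ENNReal.ofReal_le_ofReal ?_) _
    have hk' : |(k : ℝ)| ≤ 4 := by
      rw [abs_le]; constructor
      · exact_mod_cast hk.1
      · exact_mod_cast hk.2
    have := e1_le (σ + s) j k hk'
    push_cast
    calc (2:ℝ) ^ (σ * j) * (C * D.Gf * (2:ℝ) ^ (s * j))
        = (C * D.Gf) * ((2:ℝ) ^ (σ * j) * (2:ℝ) ^ (s * j)) := by ring
      _ = (C * D.Gf) * (2:ℝ) ^ ((σ + s) * j) := by rw [two_rpow_mul, ← add_mul]
      _ ≤ (C * D.Gf) * ((2:ℝ) ^ (4 * |σ + s|) * (2:ℝ) ^ ((σ + s) * (j + k))) := by gcongr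
      _ = _ := by ring
  · rw [← ENNReal.tsum_mul_left, ← ENNReal.tsum_mul_left]
    refine ENNReal.tsum_le_tsum fun n => ?_
    simp only [Finset.mul_sum]
    refine Finset.sum_le_sum fun i _ => ?_
    rw [← mul_assoc, ← mul_assoc, ← mul_assoc, ← ENNReal.ofReal_mul (by positivity),
      ← ENNReal.ofReal_mul (by positivity), ← ENNReal.ofReal_mul (by positivity)]
    refine mul_le_mul_left (ENNReal.ofReal_le_ofReal ?_) _
    have := e2_le σ s j n
    push_cast
    calc (2:ℝ) ^ (σ * j) * (C * D.Gg * (2:ℝ) ^ (s * j) * (2:ℝ) ^ ((s - 1) * n))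
        = (C * D.Gg) * ((2:ℝ) ^ (σ * j) * ((2:ℝ) ^ (s * j) * (2:ℝ) ^ ((s - 1) * n))) := by ring
      _ ≤ (C * D.Gg) * ((2:ℝ) ^ (4 * |σ + s|) *
          ((2:ℝ) ^ (-(σ + 1) * n) * (2:ℝ) ^ ((σ + s) * (j - 4 + n)))) := by gcongr
      _ = _ := by ring

lemma main_est (s σ : ℝ) (hs : 0 ≤ s) (hσ : -1 < σ) (p r : ℝ≥0∞)
    (hp : 1 ≤ p) (hr : 1 ≤ r) (hφ : IsDyadicBump φ) :
    ∃ C : ℝ, 0 < C ∧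
      ∀ (f : SchwartzMap (EV d) (EV d)) (g : SchwartzMap (EV d) ℂ),
        (∀ x, (∑ i : Fin d, fderiv ℝ (fun y => f y i) x (EuclideanSpace.single i 1)) = 0) →
        besovNorm φ σ p r (cmt s f g)
          ≤ ENNReal.ofReal C *
            (eLpNorm (fun x => fderiv ℝ (fun y => f y) x) ⊤ volume
                * besovNorm φ (σ + s) p r (fun x => g x)
              + eLpNorm (fun x => fderiv ℝ (fun y => g y) x) ⊤ volume
                * (∑ i : Fin d, besovNorm φ (σ + s) p r (fun x => ((f x i : ℝ) : ℂ)))) := by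
  rcases hs.eq_or_lt with h0 | hpos
  · refine ⟨1, one_pos, fun f g hdiv => ?_⟩
    have : besovNorm φ σ p r (cmt s f g) = 0 := by
      apply besov_zero hr
      intro j
      by_cases hR : Integrable (cmt s f g)
      · rw [block_comm hφ hs f g hdiv hR j]
        have hW : (fun z => ∑ i, Wi φ (mkD s hs f g hdiv) j i z) = fun _ => 0 := by
          ext z
          refine Finset.sum_eq_zero fun i _ => ?_
          unfold Wi
          subst h0
          simp
        rw [hW]
        ext x
        simp [BT, PH]
      · exact block_undef hR j
    rw [this]; exact zero_le
  · obtain ⟨C0, hC0, hfull⟩ := full_est (d := d) hφ hpos p hp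
    set T := (∑' n : ℕ, ENNReal.ofReal ((2:ℝ) ^ (-(σ + 1) * n))) with hT
    have hTt : T ≠ ⊤ := w_sum hσ
    set M := (2 * π * C0) * (2:ℝ) ^ (4 * |σ + s|) with hM
    have hpi := Real.pi_pos
    have hM0 : 0 ≤ M := by positivity
    refine ⟨M * (9 + T.toReal) + 1, by positivity, fun f g hdiv => ?_⟩
    by_cases hR : Integrable (cmt s f g)
    swap
    · rw [besov_zero hr σ p _ (fun j => block_undef hR j)]; exact zero_le
    set D := mkD s hs f g hdiv with hD
    have hGf : ENNReal.ofReal D.Gf = eLpNorm (fun x => fderiv ℝ (fun y => f y) x) ⊤ volume :=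
      ENNReal.ofReal_toReal (schw_fderiv f).1
    have hGg : ENNReal.ofReal D.Gg = eLpNorm (fun x => fderiv ℝ (fun y => g y) x) ⊤ volume :=
      ENNReal.ofReal_toReal (schw_fderiv g).1
    have hX : ∀ j : ℤ, ENNReal.ofReal ((2:ℝ) ^ (σ * j)) * eLpNorm (lpBlock φ j (cmt s f g)) p volume ≤ _ :=
      fun j => hX_est (φ := φ) (σ := σ) p (C := 2 * π * C0) (by positivity) D j _ (by
        rw [block_comm hφ hs f g hdiv hR j, eL_const]
        have hn : ‖(2 * π * Complex.I : ℂ)‖ₑ = ENNReal.ofReal (2 * π) := by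
          rw [← ofReal_norm]
          congr 1
          simp [abs_of_pos hpi]
        rw [hn]
        refine (mul_le_mul_right (hfull D j) _).trans (le_of_eq ?_)
        rw [mul_add, ← mul_assoc, ← ENNReal.tsum_mul_left, ← ENNReal.ofReal_mul (by positivity)]
        congr 1
        · congr 2; ring
        · congr 1; ext n
          rw [← mul_assoc, ← ENNReal.ofReal_mul (by positivity)]
          congr 2; ring)
    have hfinal := seq_est hr Finset.univ
      (fun j : ℤ => ENNReal.ofReal ((2:ℝ) ^ (σ * j)) * eLpNorm (lpBlock φ j (cmt s f g)) p volume)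
      (fun k : ℤ => ENNReal.ofReal ((2:ℝ) ^ ((σ + s) * k)) * nb φ p D.b k)
      (fun (i : Fin d) (k : ℤ) => ENNReal.ofReal ((2:ℝ) ^ ((σ + s) * k)) * nb φ p (D.a i) k)
      (ENNReal.ofReal (M * D.Gf)) (ENNReal.ofReal (M * D.Gg))
      (fun n : ℕ => ENNReal.ofReal ((2:ℝ) ^ (-(σ + 1) * n))) hX
    rw [← besov_eq hr] at hfinal
    refine hfinal.trans ?_
    have eg : besovNorm φ (σ + s) p r (fun x => g x) =
      sN r (fun k : ℤ => ENNReal.ofReal ((2:ℝ) ^ ((σ + s) * k)) * nb φ p D.b k) := besov_nb hr _ _ _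
    have ef : ∀ i, besovNorm φ (σ + s) p r (fun x => ((f x i : ℝ) : ℂ)) =
      sN r (fun k : ℤ => ENNReal.ofReal ((2:ℝ) ^ ((σ + s) * k)) * nb φ p (D.a i) k) :=
        fun i => besov_nb hr _ _ _
    rw [eg]
    simp only [ef]
    rw [← hGf, ← hGg, ← hT, mul_add]
    have hTr : ENNReal.ofReal T.toReal = T := ENNReal.ofReal_toReal hTt
    have hT0 : 0 ≤ T.toReal := ENNReal.toReal_nonneg
    have hf0 := D.Gf0
    have hg0 := D.Gg0
    refine add_le_add ?_ ?_
    · rw [← mul_assoc, ← mul_assoc]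
      refine mul_le_mul_left ?_ _
      rw [show (9 : ℝ≥0∞) = ENNReal.ofReal 9 by simp, ← ENNReal.ofReal_mul (by positivity),
        ← ENNReal.ofReal_mul (by positivity)]
      apply ENNReal.ofReal_le_ofReal
      have h1 : M * 9 ≤ M * (9 + T.toReal) + 1 := by nlinarith
      calc M * D.Gf * 9 = M * 9 * D.Gf := by ring
        _ ≤ _ := by gcongr
    · rw [← mul_assoc, ← mul_assoc]
      refine mul_le_mul_left ?_ _
      rw [← ENNReal.ofReal_mul (by positivity)]
      refine (le_of_eq (congrArg (fun t => ENNReal.ofReal (M * D.Gg) * t) hTr.symm)).trans ?_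
      rw [← ENNReal.ofReal_mul (by positivity)]
      apply ENNReal.ofReal_le_ofReal
      have h1 : M * T.toReal ≤ M * (9 + T.toReal) + 1 := by nlinarith
      calc M * D.Gg * T.toReal = M * T.toReal * D.Gg := by ring
        _ ≤ _ := by gcongr

end fin



/-- Proposition 2.7, generalized commutator estimate: for `s ≥ 0`,
`σ > −1`, `1 ≤ p, r ≤ ∞`, a smooth divergence-free vector field `f` and a smooth `g`
(both rapidly decaying),
`‖[Λˢ, f·∇]g‖_{Ḃ^σ_{p,r}} ≤ C (‖∇f‖_{L^∞} ‖g‖_{Ḃ^{σ+s}_{p,r}} + ‖∇g‖_{L^∞} ‖f‖_{Ḃ^{σ+s}_{p,r}})`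
with `C` independent of `f` and `g`. -/
theorem stmt_17 (d : ℕ) (s σ : ℝ) (hs : 0 ≤ s) (hσ : -1 < σ) (p r : ℝ≥0∞)
    (hp : 1 ≤ p) (hr : 1 ≤ r)
    (φ : EuclideanSpace ℝ (Fin d) → ℝ) (hφ : IsDyadicBump φ) :
    ∃ C : ℝ, 0 < C ∧
      ∀ (f : SchwartzMap (EuclideanSpace ℝ (Fin d)) (EuclideanSpace ℝ (Fin d)))
        (g : SchwartzMap (EuclideanSpace ℝ (Fin d)) ℂ),
        (∀ x, (∑ i : Fin d,
          fderiv ℝ (fun y => f y i) x (EuclideanSpace.single i 1)) = 0) →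
        besovNorm φ σ p r
          (fun x =>
            fracLap s (fun y => ∑ j : Fin d,
              (f y j : ℂ) * fderiv ℝ (fun z => g z) y (EuclideanSpace.single j 1)) x
            - ∑ j : Fin d, (f x j : ℂ) *
                fderiv ℝ (fracLap s (fun z => g z)) x (EuclideanSpace.single j 1))
          ≤ ENNReal.ofReal C *
            (eLpNorm (fun x => fderiv ℝ (fun y => f y) x) ⊤ volume
                * besovNorm φ (σ + s) p r (fun x => g x)
              + eLpNorm (fun x => fderiv ℝ (fun y => g y) x) ⊤ volume
                * (∑ i : Fin d, besovNorm φ (σ + s) p r (fun x => ((f x i : ℝ) : ℂ)))) := by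
  exact main_est s σ hs hσ p r hp hr hφ
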